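/- Let H₁ and H₂ be distinct topoplanes belonging to an arrangement of topoplanes 𝓗 in ℝⁿ. Then H₁ and H₂ cross if and only if H₁ ∩ H₂ ≠ ∅ and every connected component of ℝⁿ ∖ (H₁ ∪ H₂) has closure meeting both H₁ ∖ H₂ and H₂ ∖ H₁. -/

import Mathlib

open Set

/-- The `i`-th coordinate hyperplane in `ℝⁿ` (by convention the whole space if `i ≥ n`). -/
def coordHyp (n i : ℕ) : Set (Fin n → ℝ) := {x | ∀ h : i < n, x ⟨i, h⟩ = 0}

/-- `H` is a topological hyperplane (topoplane) in `ℝⁿ`: some self-homeomorphism of `ℝⁿ`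
carries `H` onto the coordinate hyperplane `{x | x₁ = 0}`. -/
def IsTopoplane {n : ℕ} (H : Set (Fin n → ℝ)) : Prop :=
  ∃ e : (Fin n → ℝ) ≃ₜ (Fin n → ℝ), e '' H = coordHyp n 0

/-- `Z` is a relative topoplane in `Y ⊆ ℝⁿ`: `Z ⊆ Y` and some homeomorphism of `Y`
(with the subspace topology) onto some `ℝᵈ`, `d ≥ 1`, carries `Z` onto `{x | x₁ = 0}`. -/
def IsRelTopoplane {n : ℕ} (Y Z : Set (Fin n → ℝ)) : Prop :=
  Z ⊆ Y ∧ ∃ d : ℕ, 1 ≤ d ∧ ∃ φ : Y ≃ₜ (Fin d → ℝ),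
    φ '' {y : Y | (y : Fin n → ℝ) ∈ Z} = coordHyp d 0

/-- `Y` is a flat of the family `𝓗`: a nonempty intersection of a subfamily of `𝓗`
(the empty intersection being all of `ℝⁿ`). -/
def IsFlat {n : ℕ} (𝓗 : Set (Set (Fin n → ℝ))) (Y : Set (Fin n → ℝ)) : Prop :=
  (∃ 𝓢 ⊆ 𝓗, Y = ⋂₀ 𝓢) ∧ Y.Nonempty

/-- `𝓗` is an arrangement of topoplanes in `ℝⁿ`: a finite set of topoplanes such that for
every `H ∈ 𝓗` and every flat `Y`, either `Y ⊆ H`, or `H ∩ Y = ∅`, or `H ∩ Y` is a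
relative topoplane in `Y`. -/
def IsArrangement {n : ℕ} (𝓗 : Set (Set (Fin n → ℝ))) : Prop :=
  𝓗.Finite ∧ (∀ H ∈ 𝓗, IsTopoplane H) ∧
    ∀ H ∈ 𝓗, ∀ Y : Set (Fin n → ℝ), IsFlat 𝓗 Y →
      Y ⊆ H ∨ H ∩ Y = ∅ ∨ IsRelTopoplane Y (H ∩ Y)

/-- `Y` has dimension `d`: it is homeomorphic, in the subspace topology, to `ℝᵈ`. -/
def HasDim {n : ℕ} (Y : Set (Fin n → ℝ)) (d : ℕ) : Prop :=
  Nonempty (Y ≃ₜ (Fin d → ℝ))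

/-- Topoplanes `H₁`, `H₂` cross: some self-homeomorphism of `ℝⁿ` carries them
simultaneously onto the coordinate hyperplanes `{x | x₁ = 0}` and `{x | x₂ = 0}`. -/
def Crosses {n : ℕ} (H₁ H₂ : Set (Fin n → ℝ)) : Prop :=
  ∃ e : (Fin n → ℝ) ≃ₜ (Fin n → ℝ), e '' H₁ = coordHyp n 0 ∧ e '' H₂ = coordHyp n 1

/-- The pairwise condition for an arrangement to be affine: any two distinct members
are disjoint or cross. -/
def PairwiseAffine {n : ℕ} (𝓗 : Set (Set (Fin n → ℝ))) : Prop :=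
  ∀ H₁ ∈ 𝓗, ∀ H₂ ∈ 𝓗, H₁ ≠ H₂ → H₁ ∩ H₂ = ∅ ∨ Crosses H₁ H₂

section InvarianceOfDimension

open MeasureTheory Module

variable {E : Type*} [NormedAddCommGroup E] [InnerProductSpace ℝ E] [FiniteDimensional ℝ E]

lemma exists_polynomial_det_one_add_smul_matrix {d : ℕ} (A : Matrix (Fin d) (Fin d) ℝ) :
    ∃ p : Polynomial ℝ, p.natDegree ≤ d ∧ ∀ t : ℝ, (1 + t • A).det = p.eval t := by
  refine ⟨((Polynomial.X : Polynomial ℝ) • A.map Polynomial.C +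
    (1 : Matrix (Fin d) (Fin d) ℝ).map Polynomial.C).det,
    (Polynomial.natDegree_det_X_add_C_le A 1).trans (by simp), fun t => ?_⟩
  have h2 := (Polynomial.evalRingHom t).map_det
    ((Polynomial.X : Polynomial ℝ) • A.map Polynomial.C +
      (1 : Matrix (Fin d) (Fin d) ℝ).map Polynomial.C)
  rw [Polynomial.coe_evalRingHom] at h2
  rw [h2]
  congr 1
  ext i j
  simp only [Matrix.add_apply, Matrix.smul_apply, RingHom.mapMatrix_apply, Matrix.map_apply,
    smul_eq_mul, Polynomial.coe_evalRingHom, Polynomial.eval_add, Polynomial.eval_mul,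
    Polynomial.eval_X, Polynomial.eval_C]
  ring

lemma exists_polynomial_det_one_add_smul (M : E →L[ℝ] E) :
    ∃ p : Polynomial ℝ, p.natDegree ≤ finrank ℝ E ∧
      ∀ t : ℝ, (ContinuousLinearMap.id ℝ E + t • M).det = p.eval t := by
  obtain ⟨p, hp, h⟩ := exists_polynomial_det_one_add_smul_matrix
    (LinearMap.toMatrix (finBasis ℝ E) (finBasis ℝ E) (M : E →ₗ[ℝ] E))
  refine ⟨p, hp, fun t => ?_⟩
  rw [← h t, ContinuousLinearMap.det, ← LinearMap.det_toMatrix (finBasis ℝ E),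
      ContinuousLinearMap.toLinearMap_add, ContinuousLinearMap.toLinearMap_smul, map_add, map_smul,
      ContinuousLinearMap.coe_id, LinearMap.toMatrix_id]

lemma exists_weights_eval_one (d : ℕ) {τ : ℝ} (hτ : 0 < τ) :
    ∃ w v : ℕ → ℝ, (∀ i, 0 < v i ∧ v i ≤ τ) ∧ ∀ p : Polynomial ℝ, p.natDegree ≤ d →
      p.eval 1 = ∑ i ∈ Finset.range (d + 1), w i * p.eval (v i) := by
  let v : ℕ → ℝ := fun i => τ / (i + 1)
  have hv : Set.InjOn v (Finset.range (d + 1) : Set ℕ) := by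
    intro i _ j _ h
    have hi : (i : ℝ) + 1 ≠ 0 := by positivity
    have hj : (j : ℝ) + 1 ≠ 0 := by positivity
    simp only [v] at h
    rw [div_eq_div_iff hi hj] at h
    have := mul_left_cancel₀ hτ.ne' h
    exact_mod_cast (add_right_cancel this).symm
  refine ⟨fun i => (Lagrange.basis (Finset.range (d + 1)) v i).eval 1, v, fun i => ⟨by positivity,
    div_le_self hτ.le (by simp)⟩, fun p hp => ?_⟩
  have hdeg : p.degree < ((Finset.range (d + 1)).card : WithBot ℕ) := by
    rw [Finset.card_range]
    refine (Polynomial.degree_le_natDegree).trans_lt ?_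
    exact_mod_cast Nat.lt_succ_of_le hp
  conv_lhs => rw [Lagrange.eq_interpolate hv hdeg, Lagrange.interpolate_apply]
  simp [Polynomial.eval_finsetSum, mul_comm]

lemma det_id_add_pos {N : E →L[ℝ] E} (hN : ‖N‖ < 1) :
    0 < (ContinuousLinearMap.id ℝ E + N).det := by
  have hne : ∀ s ∈ Icc (0 : ℝ) 1, (ContinuousLinearMap.id ℝ E + s • N).det ≠ 0 := by
    intro s hs h0
    have := LinearMap.bot_lt_ker_of_det_eq_zero h0
    obtain ⟨v, hv, hv0⟩ := (Submodule.ne_bot_iff _).1 this.ne'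
    have hv' : v + s • N v = 0 := by simpa using hv
    have h1 : ‖v‖ = ‖s • N v‖ := by
      have := congrArg norm (eq_neg_of_add_eq_zero_left hv')
      rwa [norm_neg] at this
    have h2 : ‖s • N v‖ ≤ ‖N‖ * ‖v‖ := by
      rw [norm_smul, Real.norm_of_nonneg hs.1]
      calc s * ‖N v‖ ≤ 1 * ‖N v‖ := by gcongr; exact hs.2
        _ ≤ _ := by rw [one_mul]; exact N.le_opNorm v
    have : 0 < ‖v‖ := norm_pos_iff.2 hv0
    nlinarith
  have hc : ContinuousOn (fun s : ℝ => (ContinuousLinearMap.id ℝ E + s • N).det) (Icc 0 1) :=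
    (ContinuousLinearMap.continuous_det.comp (by fun_prop)).continuousOn
  by_contra! h
  have h0 : (0 : ℝ) ∈ (fun s : ℝ => (ContinuousLinearMap.id ℝ E + s • N).det) '' Icc 0 1 := by
    apply intermediate_value_Icc' zero_le_one hc
    refine ⟨by simpa using h, ?_⟩
    simp [ContinuousLinearMap.det]
  obtain ⟨s, hs, hs0⟩ := h0
  exact hne s hs hs0

/-- There is no smooth retraction onto the unit sphere. -/
lemma not_exists_contDiff_retraction :
    ¬ ∃ R : E → E, ContDiff ℝ 1 R ∧ (∀ x, ‖x‖ = 1 → R x = x) ∧ ∀ x, ‖R x‖ = 1 := by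
  rintro ⟨R, hR, hfix, hnorm⟩
  borelize E
  let D : E → E →L[ℝ] E := fun x => fderiv ℝ R x - ContinuousLinearMap.id ℝ E
  have hDc : Continuous D := (hR.continuous_fderiv one_ne_zero).sub continuous_const
  have hderiv : ∀ x, HasFDerivAt (fun x => R x - x) (D x) x := fun x =>
    ((hR.differentiable one_ne_zero x).hasFDerivAt).sub (hasFDerivAt_id x)
  obtain ⟨C, hC⟩ : ∃ C : NNReal, ∀ x ∈ Metric.closedBall (0 : E) 1, ‖D x‖₊ ≤ C := by
    obtain ⟨C, hC⟩ := (isCompact_closedBall (0 : E) 1).exists_bound_of_continuousOn hDc.continuousOn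
    refine ⟨C.toNNReal, fun x hx => ?_⟩
    rw [← NNReal.coe_le_coe]
    exact (hC x hx).trans (Real.le_coe_toNNReal C)
  have hLip : LipschitzOnWith C (fun x => R x - x) (Metric.closedBall (0 : E) 1) :=
    (convex_closedBall (0 : E) 1).lipschitzOnWith_of_nnnorm_hasFDerivWithin_le
      (fun x _ => (hderiv x).hasFDerivWithinAt) hC
  classical
  let u : E → E := fun x => if ‖x‖ ≤ 1 then R x - x else 0
  have hu1 : ∀ x, 1 ≤ ‖x‖ → u x = 0 := by
    intro x hx
    by_cases h : ‖x‖ ≤ 1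
    · simp [u, h, hfix x (le_antisymm h hx)]
    · simp [u, h]
  have hin : ∀ x, ‖x‖ ≤ 1 → ∀ y, ‖u x - u y‖ ≤ C * ‖x - y‖ := by
    intro x hx y
    by_cases hy : ‖y‖ ≤ 1
    · have := hLip.dist_le_mul x (by simpa using hx) y (by simpa using hy)
      simpa [u, hx, hy, dist_eq_norm] using this
    · push Not at hy
      obtain ⟨s, hs, hs1⟩ : (1 : ℝ) ∈ (fun s : ℝ => ‖x + s • (y - x)‖) '' Icc 0 1 := by
        apply intermediate_value_Icc zero_le_one (by fun_prop)
        constructor <;> simp [hx, hy.le]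
      set z := x + s • (y - x) with hz
      have := hLip.dist_le_mul x (by simpa using hx) z (by simpa using hs1.le)
      have huz : R z - z = 0 := by rw [hfix z hs1, sub_self]
      rw [hu1 y hy.le]
      simp only [huz, dist_eq_norm] at this
      have hxz : ‖x - z‖ ≤ ‖x - y‖ := by
        have : x - z = s • (x - y) := by rw [hz]; module
        rw [this, norm_smul, Real.norm_of_nonneg hs.1]
        exact mul_le_of_le_one_left (norm_nonneg _) hs.2
      simp only [u, hx, if_true]
      exact this.trans (by gcongr)
  have hu : ∀ x y, ‖u x - u y‖ ≤ C * ‖x - y‖ := by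
    intro x y
    by_cases hx : ‖x‖ ≤ 1
    · exact hin x hx y
    by_cases hy : ‖y‖ ≤ 1
    · rw [norm_sub_rev, norm_sub_rev x]; exact hin y hy x
    · rw [hu1 x (le_of_not_ge hx), hu1 y (le_of_not_ge hy)]
      simp only [sub_self, norm_zero]; positivity
  let B := Metric.ball (0 : E) 1
  have hBm : MeasurableSet B := Metric.isOpen_ball.measurableSet
  let F : ℝ → E → ℝ := fun t x => (ContinuousLinearMap.id ℝ E + t • D x).det
  have hFc : ∀ t, Continuous (F t) := fun t =>
    ContinuousLinearMap.continuous_det.comp (by fun_prop)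
  have hFi : ∀ t, IntegrableOn (F t) B volume := fun t =>
    ((hFc t).continuousOn.integrableOn_compact (isCompact_closedBall (0 : E) 1)).mono_set
      Metric.ball_subset_closedBall
  let τ : ℝ := 1 / (2 * (C + 1))
  have hτ : 0 < τ := by positivity
  have hτC : τ * C < 1 := by
    simp only [τ]
    rw [div_mul_eq_mul_div, div_lt_one (by positivity)]
    have := C.coe_nonneg
    linarith
  have hsmall : ∀ t, 0 < t → t ≤ τ → ∫ x in B, F t x = volume.real B := by
    intro t ht htτ
    have htC : t * C < 1 := (mul_le_mul_of_nonneg_right htτ C.coe_nonneg).trans_lt hτC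
    let f : E → E := fun x => x + t • u x
    have happ : ApproximatesLinearOn f (ContinuousLinearEquiv.refl ℝ E : E →L[ℝ] E) univ
        (t.toNNReal * C) := by
      intro x _ y _
      have : f x - f y - (x - y) = t • (u x - u y) := by simp only [f]; module
      simp only [ContinuousLinearEquiv.coe_refl, ContinuousLinearMap.coe_id', id]
      rw [this, norm_smul, Real.norm_of_nonneg ht.le, NNReal.coe_mul, Real.coe_toNNReal _ ht.le,
        mul_assoc]
      exact mul_le_mul_of_nonneg_left (hu x y) ht.le
    have hcond : Subsingleton E ∨ t.toNNReal * C <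
        ‖((ContinuousLinearEquiv.refl ℝ E).symm : E →L[ℝ] E)‖₊⁻¹ := by
      rcases subsingleton_or_nontrivial E with h | h
      · exact Or.inl h
      · right
        have : ‖((ContinuousLinearEquiv.refl ℝ E).symm : E →L[ℝ] E)‖₊ = 1 := by
          ext; simp
        rw [this, inv_one, ← NNReal.coe_lt_coe, NNReal.coe_mul, Real.coe_toNNReal _ ht.le]
        exact htC
    let φ := happ.toHomeomorph f hcond
    have hφ : ∀ x, φ x = f x := fun x => rfl
    have hout : ∀ x, x ∉ B → φ x = x := by
      intro x hx
      have : 1 ≤ ‖x‖ := by simpa [B] using hx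
      simp [hφ, f, hu1 x this]
    have himg : φ '' B = B := by
      ext y
      constructor
      · rintro ⟨x, hx, rfl⟩
        by_contra h
        have := φ.injective (hout _ h)
        rw [this] at h
        exact h hx
      · intro hy
        obtain ⟨x, rfl⟩ := φ.surjective y
        refine ⟨x, ?_, rfl⟩
        by_contra h
        rw [hout x h] at hy
        exact h hy
    have hd : ∀ x ∈ B, HasFDerivWithinAt φ (ContinuousLinearMap.id ℝ E + t • D x) B x := by
      intro x hx
      have h1 : HasFDerivAt (fun x => x + t • (R x - x))
          (ContinuousLinearMap.id ℝ E + t • D x) x :=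
        (hasFDerivAt_id x).add ((hderiv x).const_smul t)
      refine h1.hasFDerivWithinAt.congr (fun z hz => ?_) ?_
      · have : ‖z‖ ≤ 1 := by simpa [B] using (mem_ball_zero_iff.1 hz).le
        simp [hφ, f, u, this]
      · have : ‖x‖ ≤ 1 := by simpa [B] using (mem_ball_zero_iff.1 hx).le
        simp [hφ, f, u, this]
    have hint := integral_image_eq_integral_abs_det_fderiv_smul (volume : Measure E) hBm hd
      φ.injective.injOn (fun _ => (1 : ℝ))
    rw [himg] at hint
    simp only [smul_eq_mul, mul_one, integral_const, MeasurableSet.univ,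
      measureReal_restrict_apply, univ_inter] at hint
    rw [hint]
    refine setIntegral_congr_fun hBm fun x hx => ?_
    have : ‖t • D x‖ < 1 := by
      rw [norm_smul, Real.norm_of_nonneg ht.le]
      refine lt_of_le_of_lt (mul_le_mul_of_nonneg_left ?_ ht.le) htC
      exact_mod_cast hC x (Metric.ball_subset_closedBall hx)
    exact (abs_of_pos (det_id_add_pos this)).symm
  obtain ⟨w, v, hv, hwv⟩ := exists_weights_eval_one (finrank ℝ E) hτ
  have hF1 : ∀ x, F 1 x = ∑ i ∈ Finset.range (finrank ℝ E + 1), w i * F (v i) x := by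
    intro x
    obtain ⟨p, hp, hpe⟩ := exists_polynomial_det_one_add_smul (D x)
    simp only [F, hpe]
    exact hwv p hp
  have hw1 : ∑ i ∈ Finset.range (finrank ℝ E + 1), w i = 1 := by
    have := hwv 1 (by simp)
    simpa using this.symm
  have hI : ∫ x in B, F 1 x = volume.real B := by
    simp_rw [hF1]
    rw [integral_finsetSum _ fun i _ => (hFi (v i)).const_mul (w i)]
    simp_rw [integral_const_mul]
    rw [Finset.sum_congr rfl fun i _ => by rw [hsmall (v i) (hv i).1 (hv i).2], ← Finset.sum_mul,
      hw1, one_mul]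
  have hzero : ∀ x, F 1 x = 0 := by
    intro x
    by_contra h
    have hdet : (fderiv ℝ R x).det ≠ 0 := by simpa [F, D] using h
    have hinner : ∀ v, inner ℝ (R x) (fderiv ℝ R x v) = 0 := by
      intro v
      have h1 : HasFDerivAt (fun y => ‖R y‖ ^ 2) _ x :=
        ((hR.differentiable one_ne_zero x).hasFDerivAt).norm_sq
      have h2 : HasFDerivAt (fun y => ‖R y‖ ^ 2) (0 : E →L[ℝ] ℝ) x := by
        simp only [hnorm, one_pow]; exact hasFDerivAt_const _ _
      have := congrArg (fun L : E →L[ℝ] ℝ => L v) (h1.unique h2)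
      simpa using this
    have hunit : IsUnit (LinearMap.det (fderiv ℝ R x : E →ₗ[ℝ] E)) := isUnit_iff_ne_zero.2 hdet
    let e := LinearEquiv.ofIsUnitDet (f := (fderiv ℝ R x : E →ₗ[ℝ] E)) (v := finBasis ℝ E)
      (v' := finBasis ℝ E) (by rw [LinearMap.det_toMatrix]; exact hunit)
    obtain ⟨v, hv⟩ := e.surjective (R x)
    have hv' : fderiv ℝ R x v = R x := hv
    have := hinner v
    rw [hv', real_inner_self_eq_norm_sq, hnorm] at this
    norm_num at this
  simp only [hzero, integral_zero] at hI
  have : 0 < volume.real B :=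
    ENNReal.toReal_pos (Metric.measure_ball_pos volume (0 : E) one_pos).ne'
      measure_ball_lt_top.ne
  linarith

lemma exists_eq_zero_of_eq_self_outside {q : E → E} (hq : Continuous q)
    (hfix : ∀ x, 1 / 2 ≤ ‖x‖ → q x = x) : ∃ x, q x = 0 := by
  by_contra! hne
  obtain ⟨g, hg, hgq, hgS, -⟩ := hq.exists_contDiff_approx_and_eqOn 1 (ε := fun x => ‖q x‖)
    hq.norm (fun x => norm_pos_iff.2 (hne x)) (S := {x | 3 / 4 ≤ ‖x‖}) (U := {x | 1 / 2 < ‖x‖})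
    (isClosed_le continuous_const continuous_norm)
    ((isOpen_lt continuous_const continuous_norm).mem_nhdsSet.2 fun x hx => by
      simp only [mem_ofPred_eq] at hx ⊢; linarith)
    (contDiffOn_id.congr fun x hx => hfix x (le_of_lt hx))
  have hg0 : ∀ x, g x ≠ 0 := by
    intro x h
    have := hgq x
    simp [h] at this
  refine not_exists_contDiff_retraction (E := E) ⟨fun x => ‖g x‖⁻¹ • g x, ?_, fun x hx => ?_,
    fun x => ?_⟩
  · exact ((hg.norm ℝ hg0).inv fun x => norm_ne_zero_iff.2 (hg0 x)).smul hg
  · have h1 : g x = x := by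
      rw [hgS (by simp only [mem_ofPred_eq, hx]; norm_num), hfix x (by rw [hx]; norm_num)]
    simp [h1, hx]
  · simp [norm_smul, hg0 x]

variable {E' : Type*} [NormedAddCommGroup E'] [InnerProductSpace ℝ E'] [FiniteDimensional ℝ E']

lemma finrank_le_of_homeomorph (h : E ≃ₜ E') : finrank ℝ E ≤ finrank ℝ E' := by
  by_contra! hlt
  obtain ⟨P, hP, hPd, -⟩ := h.symm.continuous.exists_contDiff_approx 1
    (ε := fun _ => (1 / 16 : ℝ)) continuous_const (fun _ => by norm_num)
  have hP' : ContDiff ℝ 1 P := hP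
  obtain ⟨c, hc, hcn⟩ := Metric.dense_iff.1 (hP'.dense_compl_range_of_finrank_lt_finrank hlt)
    0 (1 / 16) (by norm_num)
  have hcn' : ‖c‖ < 1 / 16 := by simpa using hc
  let χ : E → ℝ := fun x => max 0 (min 1 (2 - 4 * ‖x‖))
  have hχc : Continuous χ := by fun_prop
  obtain ⟨x, hx⟩ := exists_eq_zero_of_eq_self_outside
    (q := fun x => x + χ x • (P (h x) - c - x))
    (by have := hP'.continuous; have := h.continuous; fun_prop)
    (fun x hx => by
      have : χ x = 0 := max_eq_left ((min_le_right _ _).trans (by linarith))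
      simp [this])
  by_cases hx4 : ‖x‖ ≤ 1 / 4
  · have : χ x = 1 := by
      simp only [χ]
      rw [min_eq_left (by linarith), max_eq_right zero_le_one]
    simp only [this, one_smul] at hx
    exact hcn ⟨h x, by rw [← sub_eq_zero, ← hx]; abel⟩
  · push Not at hx4
    have h1 : ‖P (h x) - x‖ < 1 / 16 := by
      have := hPd (h x)
      simpa [dist_eq_norm] using this
    have h2 : ‖χ x • (P (h x) - c - x)‖ ≤ 1 / 8 := by
      have hχ0 : 0 ≤ χ x := le_max_left _ _
      have hχ1 : χ x ≤ 1 := max_le zero_le_one (min_le_left _ _)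
      rw [norm_smul, Real.norm_of_nonneg hχ0]
      have h3 : ‖P (h x) - c - x‖ ≤ 1 / 8 := by
        have : P (h x) - c - x = (P (h x) - x) - c := by abel
        rw [this]
        exact (norm_sub_le _ _).trans (by linarith)
      calc χ x * ‖P (h x) - c - x‖ ≤ 1 * (1 / 8) := by gcongr
        _ = _ := one_mul _
    have h4 : x = -(χ x • (P (h x) - c - x)) := eq_neg_of_add_eq_zero_left hx
    have h5 : ‖x‖ = ‖χ x • (P (h x) - c - x)‖ := by
      conv_lhs => rw [h4]
      rw [norm_neg]
    linarith

/-- Invariance of dimension. -/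
theorem eq_of_homeomorph_pi {a b : ℕ} (h : (Fin a → ℝ) ≃ₜ (Fin b → ℝ)) : a = b := by
  let h' : EuclideanSpace ℝ (Fin a) ≃ₜ EuclideanSpace ℝ (Fin b) :=
    (EuclideanSpace.equiv (Fin a) ℝ).toHomeomorph.trans
      (h.trans (EuclideanSpace.equiv (Fin b) ℝ).symm.toHomeomorph)
  have h1 := finrank_le_of_homeomorph h'
  have h2 := finrank_le_of_homeomorph h'.symm
  simp only [finrank_euclideanSpace, Fintype.card_fin] at h1 h2
  exact le_antisymm h1 h2

end InvarianceOfDimension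

section CoverMaps

set_option linter.unusedSectionVars false

open Filter Topology

variable {E : Type*} [NormedAddCommGroup E]

/-- The behaviour at infinity that makes a map of `ℝ × ℝ × E` (slope, depth, parameter) extend by
the identity over the boundary of the half space. -/
def FixesEnds (N : ℝ × ℝ × E → ℝ × ℝ × E) : Prop :=
  (∀ (v : ℝ) (y : E), Tendsto N (atTop ×ˢ 𝓝 v ×ˢ 𝓝 y) (atTop ×ˢ 𝓝 v ×ˢ 𝓝 y)) ∧
  (∀ (v : ℝ) (y : E), Tendsto N (atBot ×ˢ 𝓝 v ×ˢ 𝓝 y) (atBot ×ˢ 𝓝 v ×ˢ 𝓝 y)) ∧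
  ∀ y : E, Tendsto N (⊤ ×ˢ atTop ×ˢ 𝓝 y) (⊤ ×ˢ atTop ×ˢ 𝓝 y)

lemma FixesEnds.comp {M N : ℝ × ℝ × E → ℝ × ℝ × E} (hM : FixesEnds M) (hN : FixesEnds N) :
    FixesEnds (M ∘ N) :=
  ⟨fun v y => (hM.1 v y).comp (hN.1 v y), fun v y => (hM.2.1 v y).comp (hN.2.1 v y),
    fun y => (hM.2.2 y).comp (hN.2.2 y)⟩

/-- Bounded displacement of the angle, bounded displacement of the depth near the axis, and
convergence of the parameter near the axis. -/
def NearAxis (F : ℝ × ℝ × E → ℝ × ℝ × E) (C : ℝ) : Prop :=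
  (∀ x, |(F x).1 - x.1| ≤ C) ∧
  (∀ y : E, ∀ᶠ x in (⊤ : Filter ℝ) ×ˢ atTop ×ˢ 𝓝 y, |(F x).2.1 - x.2.1| ≤ 2) ∧
  ∀ y : E, Tendsto (fun x => (F x).2.2) ((⊤ : Filter ℝ) ×ˢ atTop ×ˢ 𝓝 y) (𝓝 y)

/-- The angle-dependent rescaling factor of depth. -/
noncomputable def depthFactor (θ : ℝ) : ℝ := √(1 + max 0 (|θ| - 2))

lemma one_le_depthFactor (θ : ℝ) : 1 ≤ depthFactor θ :=
  Real.one_le_sqrt.2 (by simp)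

lemma depthFactor_pos (θ : ℝ) : 0 < depthFactor θ := one_pos.trans_le (one_le_depthFactor θ)

lemma continuous_depthFactor : Continuous depthFactor := by
  unfold depthFactor; fun_prop

lemma depthFactor_sq (θ : ℝ) : depthFactor θ ^ 2 = 1 + max 0 (|θ| - 2) :=
  Real.sq_sqrt (by positivity)

lemma depthFactor_eq_one {θ : ℝ} (h : |θ| ≤ 2) : depthFactor θ = 1 := by
  rw [depthFactor, max_eq_left (by linarith)]; simp

lemma abs_depthFactor_sq_sub_le (θ θ' : ℝ) :
    |depthFactor θ ^ 2 - depthFactor θ' ^ 2| ≤ |θ - θ'| := by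
  rw [depthFactor_sq, depthFactor_sq]
  have := abs_abs_sub_abs_le_abs_sub θ θ'
  rw [abs_le] at this ⊢
  constructor <;> rcases max_cases 0 (|θ| - 2) with h | h <;>
    rcases max_cases 0 (|θ'| - 2) with h' | h' <;> linarith [abs_nonneg (θ - θ')]

lemma abs_depthFactor_sub_le (θ θ' : ℝ) : |depthFactor θ - depthFactor θ'| ≤ |θ - θ'| := by
  refine le_trans ?_ (abs_depthFactor_sq_sub_le θ θ')
  have h := one_le_depthFactor θ
  have h' := one_le_depthFactor θ'
  rw [sq_sub_sq, abs_mul]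
  refine le_mul_of_one_le_left (abs_nonneg _) ?_
  rw [abs_of_nonneg (by linarith)]; linarith

lemma tendsto_depthFactor_abs {α : Type*} {l : Filter α} {f : α → ℝ}
    (h : Tendsto (fun x => |f x|) l atTop) : Tendsto (fun x => depthFactor (f x)) l atTop := by
  unfold depthFactor
  refine Real.tendsto_sqrt_atTop.comp (tendsto_atTop_mono (fun x => ?_)
    (tendsto_atTop_add_const_right l (-1) h))
  linarith [le_max_right 0 (|f x| - 2)]

/-- The self-homeomorphism of `ℝ × ℝ × E` rescaling depth by the angle. -/
noncomputable def depthRescale : (ℝ × ℝ × E) ≃ₜ (ℝ × ℝ × E) where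
  toFun x := (x.1, (x.2.1 - depthFactor x.1 ^ 2 + 1) / depthFactor x.1, x.2.2)
  invFun x := (x.1, depthFactor x.1 * x.2.1 + depthFactor x.1 ^ 2 - 1, x.2.2)
  left_inv x := by
    have := (depthFactor_pos x.1).ne'
    ext <;> simp; field_simp; ring
  right_inv x := by
    have := (depthFactor_pos x.1).ne'
    ext <;> simp; field_simp; ring
  continuous_toFun := by
    have := continuous_depthFactor
    fun_prop (disch := exact fun x => (depthFactor_pos x.1).ne')
  continuous_invFun := by
    have := continuous_depthFactor
    fun_prop

lemma depthRescale_of_abs_le {x : ℝ × ℝ × E} (h : |x.1| ≤ 2) : depthRescale x = x := by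
  ext <;> simp [depthRescale, depthFactor_eq_one h]

lemma depthRescale_conj_sub {F : ℝ × ℝ × E → ℝ × ℝ × E} {C : ℝ} (hF : ∀ x, |(F x).1 - x.1| ≤ C)
    (x : ℝ × ℝ × E)
    (h : |(F (depthRescale.symm x)).2.1 - (depthRescale.symm x).2.1| ≤ 2) :
    |(depthRescale (F (depthRescale.symm x))).2.1 - x.2.1| ≤
      (C * |x.2.1| + C + 2) / depthFactor (F (depthRescale.symm x)).1 ∧
    (0 ≤ x.2.1 →
      x.2.1 / (1 + C) - (C + 2) ≤ (depthRescale (F (depthRescale.symm x))).2.1) := by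
  obtain ⟨θ, v, y⟩ := x
  have hθ := hF (depthRescale.symm (θ, v, y))
  set x' := F (depthRescale.symm (θ, v, y))
  obtain ⟨θ', u', y'⟩ := x'
  simp only [depthRescale, Homeomorph.homeomorph_mk_coe_symm, Equiv.coe_fn_symm_mk,
    Homeomorph.homeomorph_mk_coe, Equiv.coe_fn_mk] at h hθ ⊢
  have h1 := (abs_depthFactor_sub_le θ' θ).trans hθ
  have h2 := (abs_depthFactor_sq_sub_le θ' θ).trans hθ
  have hp := one_le_depthFactor θ
  have hp' := one_le_depthFactor θ'
  set p := depthFactor θ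
  set p' := depthFactor θ'
  have hC : 0 ≤ C := (abs_nonneg _).trans h1
  constructor
  · have : (u' - p' ^ 2 + 1) / p' - v =
        (-((p' - p) * v) - (p' ^ 2 - p ^ 2) + (u' - (p * v + p ^ 2 - 1))) / p' := by
      field_simp; ring
    rw [this, abs_div, abs_of_pos (by linarith : 0 < p')]
    gcongr
    refine (abs_add_le _ _).trans (add_le_add ((abs_sub _ _).trans (add_le_add ?_ h2)) h)
    rw [abs_neg, abs_mul]; gcongr
  · intro hv
    rw [abs_le] at h h1 h2
    rw [le_div_iff₀ (by linarith)]
    have h3 : p' * (v / (1 + C)) ≤ p * v := by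
      rw [mul_div_assoc', div_le_iff₀ (by linarith)]
      nlinarith [mul_nonneg hv (by linarith : 0 ≤ p + C - p'), mul_nonneg hv hC,
        mul_nonneg (mul_nonneg hv hC) (by linarith : 0 ≤ p - 1)]
    nlinarith

lemma NearAxis.fixesEnds {F : ℝ × ℝ × E → ℝ × ℝ × E} {C : ℝ} (hF : NearAxis F C) :
    FixesEnds (fun x => depthRescale (F (depthRescale.symm x))) := by
  obtain ⟨h1, h2, h3⟩ := hF
  have key : ∀ (l : Filter ℝ), Tendsto (fun x : ℝ => |x|) l atTop →
      (∀ {f : ℝ × ℝ × E → ℝ} {v : ℝ} {y : E}, (∀ x, |f x - x.1| ≤ C) →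
        Tendsto f (l ×ˢ 𝓝 v ×ˢ 𝓝 y) l) → ∀ (v : ℝ) (y : E),
      Tendsto (fun x => depthRescale (F (depthRescale.symm x))) (l ×ˢ 𝓝 v ×ˢ 𝓝 y)
        (l ×ˢ 𝓝 v ×ˢ 𝓝 y) := by
    intro l hl hl' v y
    have e1 : Tendsto (fun x : ℝ × ℝ × E => x.1) (l ×ˢ 𝓝 v ×ˢ 𝓝 y) l := tendsto_fst
    have e2 : Tendsto (fun x : ℝ × ℝ × E => x.2.1) (l ×ˢ 𝓝 v ×ˢ 𝓝 y) (𝓝 v) :=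
      tendsto_fst.comp tendsto_snd
    have e3 : Tendsto (fun x : ℝ × ℝ × E => x.2.2) (l ×ˢ 𝓝 v ×ˢ 𝓝 y) (𝓝 y) :=
      tendsto_snd.comp tendsto_snd
    have hp := tendsto_depthFactor_abs (hl.comp e1)
    have hs : Tendsto (depthRescale.symm : ℝ × ℝ × E → _) (l ×ˢ 𝓝 v ×ˢ 𝓝 y)
        (⊤ ×ˢ atTop ×ˢ 𝓝 y) := by
      refine tendsto_top.prodMk (Tendsto.prodMk ?_ e3)
      have : Tendsto (fun x : ℝ × ℝ × E => depthFactor x.1 * (depthFactor x.1 + x.2.1) + (-1))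
          (l ×ˢ 𝓝 v ×ˢ 𝓝 y) atTop :=
        tendsto_atTop_add_const_right _ _ (hp.atTop_mul_atTop₀ (hp.atTop_add e2))
      refine this.congr fun x => ?_
      ring
    have hθ : Tendsto (fun x => (F (depthRescale.symm x)).1) (l ×ˢ 𝓝 v ×ˢ 𝓝 y) l :=
      hl' fun x => h1 (depthRescale.symm x)
    refine hθ.prodMk (Tendsto.prodMk ?_ ((h3 y).comp hs))
    have hp' := tendsto_depthFactor_abs (hl.comp hθ)
    have hq := ((((e2.abs.const_mul C).add_const C).add_const 2).div_atTop hp')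
    have hz : Tendsto (fun x : ℝ × ℝ × E =>
        (depthRescale (F (depthRescale.symm x))).2.1 - x.2.1) (l ×ˢ 𝓝 v ×ˢ 𝓝 y) (𝓝 0) :=
      squeeze_zero_norm' ((hs.eventually (h2 y)).mono fun x hx =>
        (depthRescale_conj_sub h1 x hx).1) hq
    have := hz.add e2
    simp only [sub_add_cancel, zero_add] at this
    exact this
  refine ⟨key atTop tendsto_abs_atTop_atTop ?_, key atBot tendsto_abs_atBot_atTop ?_, ?_⟩
  · intro f v y hf
    refine tendsto_atTop_mono (fun x => ?_)
      (tendsto_atTop_add_const_right _ (-C) (tendsto_fst : Tendsto _ _ _))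
    linarith [abs_le.1 (hf x)]
  · intro f v y hf
    refine tendsto_atBot_mono (fun x => ?_)
      (tendsto_atBot_add_const_right _ C (tendsto_fst : Tendsto _ _ _))
    linarith [abs_le.1 (hf x)]
  · intro y
    have e2 : Tendsto (fun x : ℝ × ℝ × E => x.2.1) ((⊤ : Filter ℝ) ×ˢ atTop ×ˢ 𝓝 y) atTop :=
      tendsto_fst.comp tendsto_snd
    have e3 : Tendsto (fun x : ℝ × ℝ × E => x.2.2) ((⊤ : Filter ℝ) ×ˢ atTop ×ˢ 𝓝 y) (𝓝 y) :=
      tendsto_snd.comp tendsto_snd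
    have hs : Tendsto (depthRescale.symm : ℝ × ℝ × E → _) ((⊤ : Filter ℝ) ×ˢ atTop ×ˢ 𝓝 y)
        (⊤ ×ˢ atTop ×ˢ 𝓝 y) := by
      refine tendsto_top.prodMk (Tendsto.prodMk ?_ e3)
      refine tendsto_atTop_mono' _ ?_ e2
      filter_upwards [e2.eventually_ge_atTop 0] with x hx
      have := one_le_depthFactor x.1
      nlinarith
    refine tendsto_top.prodMk (Tendsto.prodMk ?_ ((h3 y).comp hs))
    have hC : 0 ≤ C := (abs_nonneg _).trans (h1 0)
    refine tendsto_atTop_mono' _ ?_ (tendsto_atTop_add_const_right _ (-(C + 2))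
      (e2.atTop_div_const (by linarith : 0 < 1 + C)))
    filter_upwards [e2.eventually_ge_atTop 0, hs.eventually (h2 y)] with x hx hx'
    exact (depthRescale_conj_sub h1 x hx').2 hx

lemma clamp_sub_add_arctan {b : ℝ} (hb : 0 ≤ b) (σ : ℝ) :
    max (-Real.arctan b) (min (Real.arctan b)
      (σ - max (-b) (min b σ) + Real.arctan (max (-b) (min b σ)))) =
    Real.arctan (max (-b) (min b σ)) := by
  have ha : 0 ≤ Real.arctan b := Real.arctan_nonneg.2 hb
  rcases le_total σ (-b) with h | h
  · rw [min_eq_right (by linarith : σ ≤ b), max_eq_left h, Real.arctan_neg,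
      min_eq_right (by linarith), max_eq_left (by linarith)]
  rcases le_total σ b with h' | h'
  · have h1 := Real.arctan_mono h'
    have h2 := Real.arctan_mono h
    rw [Real.arctan_neg] at h2
    rw [min_eq_right h', max_eq_right h, sub_self, zero_add, min_eq_right h1, max_eq_right h2]
  · rw [min_eq_left h', max_eq_right (neg_le_self hb), min_eq_left (by linarith),
      max_eq_right (neg_le_self ha)]

lemma clamp_sub_add_tan {b : ℝ} (hb : 0 ≤ b) (s : ℝ) :
    max (-b) (min b (s - max (-Real.arctan b) (min (Real.arctan b) s) +
      Real.tan (max (-Real.arctan b) (min (Real.arctan b) s)))) =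
    Real.tan (max (-Real.arctan b) (min (Real.arctan b) s)) := by
  have ha : 0 ≤ Real.arctan b := Real.arctan_nonneg.2 hb
  rcases le_total s (-Real.arctan b) with h | h
  · rw [min_eq_right (by linarith : s ≤ Real.arctan b), max_eq_left h, Real.tan_neg,
      Real.tan_arctan, min_eq_right (by linarith), max_eq_left (by linarith)]
  rcases le_total s (Real.arctan b) with h' | h'
  · have h1 : Real.arctan (Real.tan s) = s := Real.arctan_tan
      (by linarith [Real.arctan_lt_pi_div_two b]) (by linarith [Real.arctan_lt_pi_div_two b])
    have h2 : Real.tan s ≤ b := Real.arctan_strictMono.le_iff_le.1 (by rwa [h1])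
    have h3 : -b ≤ Real.tan s := Real.arctan_strictMono.le_iff_le.1 (by
      rwa [h1, Real.arctan_neg])
    rw [min_eq_right h', max_eq_right h, sub_self, zero_add, min_eq_right h2, max_eq_right h3]
  · rw [min_eq_left h', max_eq_right (neg_le_self ha), Real.tan_arctan,
      min_eq_left (by linarith), max_eq_right (neg_le_self hb)]

/-- The self-homeomorphism of `ℝ × ℝ × E` replacing the slope by the angle, for slopes bounded
by `b`. -/
noncomputable def slopeSqueeze (b : ℝ × E → ℝ) (hb : Continuous b) (hb0 : ∀ x, 0 ≤ b x) :
    (ℝ × ℝ × E) ≃ₜ (ℝ × ℝ × E) where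
  toFun x := (x.1 - max (-b x.2) (min (b x.2) x.1) +
    Real.arctan (max (-b x.2) (min (b x.2) x.1)), x.2)
  invFun x := (x.1 - max (-Real.arctan (b x.2)) (min (Real.arctan (b x.2)) x.1) +
    Real.tan (max (-Real.arctan (b x.2)) (min (Real.arctan (b x.2)) x.1)), x.2)
  left_inv x := by
    refine Prod.ext ?_ rfl
    simp only [clamp_sub_add_arctan (hb0 x.2), Real.tan_arctan]
    ring
  right_inv x := by
    refine Prod.ext ?_ rfl
    simp only [clamp_sub_add_tan (hb0 x.2)]
    rw [Real.arctan_tan]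
    · ring
    · exact (neg_lt_neg (Real.arctan_lt_pi_div_two _)).trans_le (le_max_left _ _)
    · refine max_lt ?_ ((min_le_left _ _).trans_lt (Real.arctan_lt_pi_div_two _))
      linarith [Real.arctan_nonneg.2 (hb0 x.2), Real.pi_pos]
  continuous_toFun := by fun_prop
  continuous_invFun := by
    refine Continuous.prodMk (Continuous.add (by fun_prop) ?_) continuous_snd
    refine continuous_iff_continuousAt.2 fun x => ContinuousAt.comp (g := Real.tan)
      (Real.continuousAt_tan.2 (ne_of_gt (Real.cos_pos_of_mem_Ioo ⟨?_, ?_⟩)))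
      (Continuous.continuousAt (by fun_prop))
    · exact (neg_lt_neg (Real.arctan_lt_pi_div_two _)).trans_le (le_max_left _ _)
    · refine max_lt ?_ ((min_le_left _ _).trans_lt (Real.arctan_lt_pi_div_two _))
      linarith [Real.arctan_nonneg.2 (hb0 x.2), Real.pi_pos]

lemma slopeSqueeze_tan (b : ℝ × E → ℝ) (hb : Continuous b) (hb0 : ∀ x, 0 ≤ b x) {θ : ℝ}
    {z : ℝ × E} (hθ : |θ| < Real.pi / 2) (h : |Real.tan θ| ≤ b z) :
    slopeSqueeze b hb hb0 (Real.tan θ, z) = (θ, z) := by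
  rw [abs_le] at h
  rw [abs_lt] at hθ
  refine Prod.ext ?_ rfl
  simp [slopeSqueeze, min_eq_right h.2, max_eq_right h.1, Real.arctan_tan hθ.1 hθ.2]

lemma fixesEnds_of_bounded_displacement {F : ℝ × ℝ × E → ℝ × ℝ × E} {b : ℝ × E → ℝ}
    (hb : Continuous b) (h2 : ∀ x, (F x).2 = x.2) (h1 : ∀ x, |(F x).1 - x.1| ≤ b x.2) :
    FixesEnds F := by
  have key : ∀ l : Filter ℝ, (∀ v : ℝ, ∀ y : E, Tendsto (fun x : ℝ × ℝ × E => (F x).1)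
      (l ×ˢ 𝓝 v ×ˢ 𝓝 y) l) → ∀ v : ℝ, ∀ y : E,
      Tendsto F (l ×ˢ 𝓝 v ×ˢ 𝓝 y) (l ×ˢ 𝓝 v ×ˢ 𝓝 y) := fun l hl v y =>
    (hl v y).prodMk (tendsto_snd.congr fun x => (h2 x).symm)
  have hbt : ∀ (l : Filter ℝ) (v : ℝ) (y : E),
      Tendsto (fun x : ℝ × ℝ × E => b x.2) (l ×ˢ 𝓝 v ×ˢ 𝓝 y) (𝓝 (b (v, y))) := fun l v y => by
    rw [← nhds_prod_eq]
    exact (hb.tendsto _).comp tendsto_snd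
  refine ⟨key _ fun v y => ?_, key _ fun v y => ?_, fun y => ?_⟩
  · refine tendsto_atTop_mono (fun x => ?_)
      ((tendsto_fst : Tendsto (fun x : ℝ × ℝ × E => x.1) _ _).atTop_add (hbt _ v y).neg)
    linarith [abs_le.1 (h1 x)]
  · refine tendsto_atBot_mono (fun x => ?_)
      ((tendsto_fst : Tendsto (fun x : ℝ × ℝ × E => x.1) _ _).atBot_add (hbt _ v y))
    linarith [abs_le.1 (h1 x)]
  · exact tendsto_top.prodMk (tendsto_snd.congr fun x => (h2 x).symm)

lemma slopeSqueeze_displacement (b : ℝ × E → ℝ) (hb : Continuous b) (hb0 : ∀ x, 0 ≤ b x)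
    (x : ℝ × ℝ × E) : |(slopeSqueeze b hb hb0 x).1 - x.1| ≤ b x.2 + Real.pi / 2 := by
  have e : (slopeSqueeze b hb hb0 x).1 - x.1 = Real.arctan (max (-b x.2) (min (b x.2) x.1)) -
    max (-b x.2) (min (b x.2) x.1) := by simp [slopeSqueeze]; ring
  rw [e]
  set κ := max (-b x.2) (min (b x.2) x.1)
  have h1 : -b x.2 ≤ κ := le_max_left _ _
  have h2 : κ ≤ b x.2 := max_le (by linarith [hb0 x.2]) (min_le_left _ _)
  rw [abs_le]
  constructor <;> linarith [Real.arctan_lt_pi_div_two κ, Real.neg_pi_div_two_lt_arctan κ]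

lemma fixesEnds_slopeSqueeze (b : ℝ × E → ℝ) (hb : Continuous b) (hb0 : ∀ x, 0 ≤ b x) :
    FixesEnds (slopeSqueeze b hb hb0) ∧ FixesEnds (slopeSqueeze b hb hb0).symm := by
  constructor
  · exact fixesEnds_of_bounded_displacement (b := fun z => b z + Real.pi / 2) (by fun_prop)
      (fun x => rfl) (slopeSqueeze_displacement b hb hb0)
  · refine fixesEnds_of_bounded_displacement (b := fun z => b z + Real.pi / 2) (by fun_prop)
      (fun x => rfl) fun x => ?_
    have := slopeSqueeze_displacement b hb hb0 ((slopeSqueeze b hb hb0).symm x)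
    rw [Homeomorph.apply_symm_apply, abs_sub_comm] at this
    exact this

theorem exists_fixesEnds (Φ : (ℝ × ℝ × E) ≃ₜ (ℝ × ℝ × E)) (C : ℝ) (h : NearAxis Φ C)
    (h' : NearAxis Φ.symm C) (b : ℝ × E → ℝ) (hb : Continuous b) (hb0 : ∀ x, 0 ≤ b x)
    (hΦ : ∀ θ z, (Φ (θ, z)).1 = 0 → |θ| < Real.pi / 2 ∧ |Real.tan θ| ≤ b z) :
    ∃ N : (ℝ × ℝ × E) ≃ₜ (ℝ × ℝ × E), FixesEnds N ∧ FixesEnds N.symm ∧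
      ∀ θ z, |θ| < Real.pi / 2 → ((N (Real.tan θ, z)).1 = 0 ↔ (Φ (θ, z)).1 = 0) := by
  refine ⟨(slopeSqueeze b hb hb0).trans (depthRescale.symm.trans (Φ.trans depthRescale)),
    h.fixesEnds.comp (fixesEnds_slopeSqueeze b hb hb0).1,
    (fixesEnds_slopeSqueeze b hb hb0).2.comp h'.fixesEnds, fun θ z hθ => ?_⟩
  have hpi : Real.pi / 2 < 2 := by linarith [Real.pi_lt_four]
  have hs : ∀ s, |s| < Real.pi / 2 →
      depthRescale.symm ((s, z) : ℝ × ℝ × E) = (s, z) := fun s hs => by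
    rw [Homeomorph.symm_apply_eq, depthRescale_of_abs_le (hs.le.trans hpi.le)]
  constructor
  · intro h0
    set s := (slopeSqueeze b hb hb0 (Real.tan θ, z)).1 with hsdef
    have hG : slopeSqueeze b hb hb0 (Real.tan θ, z) = (s, z) := rfl
    have h0' : (Φ (depthRescale.symm (s, z))).1 = 0 := h0
    have hs1 : |s| < Real.pi / 2 := (hΦ _ _ h0').1
    rw [hs s hs1] at h0'
    have := (slopeSqueeze b hb hb0).injective
      (hG.trans (slopeSqueeze_tan b hb hb0 hs1 (hΦ _ _ h0').2).symm)
    have h1 := Real.tan_inj_of_lt_of_lt_pi_div_two (abs_lt.1 hθ).1 (abs_lt.1 hθ).2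
      (abs_lt.1 hs1).1 (abs_lt.1 hs1).2 (congrArg Prod.fst this)
    rwa [h1]
  · intro h0
    change (Φ (depthRescale.symm (slopeSqueeze b hb hb0 (Real.tan θ, z)))).1 = 0
    rwa [slopeSqueeze_tan b hb hb0 hθ (hΦ _ _ h0).2, hs θ hθ]

/-- The chart of the half space `0 < re` by slope, depth and parameter. -/
noncomputable def halfChart (ℓ : ℝ ≃o ℝ) (x : ℝ × ℝ × E) : E × ℂ :=
  (x.2.2, Complex.exp (((-ℓ x.2.1 : ℝ) : ℂ) + ((Real.arctan x.1 : ℝ) : ℂ) * Complex.I))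

/-- The inverse of `halfChart`. -/
noncomputable def halfChartInv (ℓ : ℝ ≃o ℝ) (p : E × ℂ) : ℝ × ℝ × E :=
  (p.2.im / p.2.re, ℓ.symm (-Real.log ‖p.2‖), p.1)

variable (ℓ : ℝ ≃o ℝ)

lemma re_halfChart_pos (x : ℝ × ℝ × E) : 0 < (halfChart ℓ x).2.re := by
  simp only [halfChart, Complex.exp_re]
  have : 0 < Real.cos (Real.arctan x.1) := Real.cos_arctan_pos _
  simp only [Complex.add_re, Complex.ofReal_re, Complex.mul_re, Complex.I_re, Complex.add_im,
    Complex.ofReal_im, Complex.mul_im, Complex.I_im]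
  simp only [mul_zero, mul_one, zero_add, sub_zero, add_zero]
  positivity

lemma im_halfChart_eq_zero_iff (x : ℝ × ℝ × E) : (halfChart ℓ x).2.im = 0 ↔ x.1 = 0 := by
  simp only [halfChart, Complex.exp_im]
  simp only [Complex.add_re, Complex.ofReal_re, Complex.mul_re, Complex.I_re, Complex.add_im,
    Complex.ofReal_im, Complex.mul_im, Complex.I_im]
  simp only [mul_zero, mul_one, zero_add, sub_zero, add_zero, mul_eq_zero, Real.exp_ne_zero,
    false_or]
  rw [Real.sin_arctan, div_eq_zero_iff]
  have : √(1 + x.1 ^ 2) ≠ 0 := by positivity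
  simp [this]

lemma halfChart_halfChartInv {p : E × ℂ} (hp : 0 < p.2.re) :
    halfChart ℓ (halfChartInv ℓ p) = p := by
  refine Prod.ext rfl ?_
  have h0 : p.2 ≠ 0 := fun h => by simp [h] at hp
  have ha := abs_lt.1 (Complex.abs_arg_lt_pi_div_two_iff.2 (Or.inl hp))
  simp only [halfChart, halfChartInv, OrderIso.apply_symm_apply, neg_neg]
  rw [← Complex.tan_arg, Real.arctan_tan ha.1 ha.2]
  exact Complex.exp_log h0

lemma halfChartInv_halfChart (x : ℝ × ℝ × E) : halfChartInv ℓ (halfChart ℓ x) = x := by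
  obtain ⟨σ, v, y⟩ := x
  refine Prod.ext ?_ (Prod.ext ?_ rfl)
  · have : Real.tan (Real.arctan σ) = σ := Real.tan_arctan σ
    rw [Real.tan_eq_sin_div_cos] at this
    simp only [halfChartInv, halfChart, Complex.exp_re, Complex.exp_im]
    simp only [Complex.add_re, Complex.ofReal_re, Complex.mul_re, Complex.I_re, Complex.add_im,
      Complex.ofReal_im, Complex.mul_im, Complex.I_im]
    simp only [mul_zero, mul_one, zero_add, sub_zero, add_zero]
    rw [mul_div_mul_left _ _ (Real.exp_ne_zero _), this]
  · simp only [halfChartInv, halfChart, Complex.norm_exp, Complex.add_re, Complex.ofReal_re,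
      Complex.mul_re, Complex.I_re, Complex.ofReal_im, Complex.I_im, mul_zero, zero_mul, sub_zero,
      add_zero, Real.log_exp, neg_neg, OrderIso.symm_apply_apply]

lemma continuous_halfChart : Continuous (halfChart ℓ : ℝ × ℝ × E → E × ℂ) := by
  have := ℓ.continuous
  unfold halfChart
  fun_prop

lemma tendsto_depth_nhds {p : E × ℂ} (h : p.2 ≠ 0) :
    Tendsto (fun q : E × ℂ => ℓ.symm (-Real.log ‖q.2‖)) (𝓝 p)
      (𝓝 (ℓ.symm (-Real.log ‖p.2‖))) := by
  have h1 : ContinuousAt (fun q : E × ℂ => -Real.log ‖q.2‖) p :=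
    ((Real.continuousAt_log (norm_ne_zero_iff.2 h)).comp
      (f := fun q : E × ℂ => ‖q.2‖) (by fun_prop)).neg
  exact ℓ.symm.continuous.continuousAt.comp h1

lemma tendsto_depth_atTop {p : E × ℂ} (h : p.2 = 0) :
    Tendsto (fun q : E × ℂ => ℓ.symm (-Real.log ‖q.2‖)) (𝓝 p ⊓ 𝓟 {q | q.2 ≠ 0}) atTop := by
  refine ℓ.symm.tendsto_atTop.comp (tendsto_neg_atBot_atTop.comp ?_)
  refine Real.tendsto_log_nhdsGT_zero.comp (tendsto_nhdsWithin_iff.2 ⟨?_, ?_⟩)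
  · refine Tendsto.mono_left ?_ inf_le_left
    have : ContinuousAt (fun q : E × ℂ => ‖q.2‖) p := by fun_prop
    simpa [ContinuousAt, h] using this
  · filter_upwards [mem_inf_of_right (mem_principal_self _)] with q hq
    exact norm_pos_iff.2 hq

lemma continuousAt_halfChartInv {p : E × ℂ} (h : 0 < p.2.re) :
    ContinuousAt (halfChartInv ℓ) p := by
  have h0 : p.2 ≠ 0 := fun h' => by simp [h'] at h
  refine ContinuousAt.prodMk (ContinuousAt.div ?_ ?_ h.ne')
    (ContinuousAt.prodMk (tendsto_depth_nhds ℓ h0) continuousAt_fst)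
  · exact (Complex.continuous_im.comp continuous_snd).continuousAt
  · exact (Complex.continuous_re.comp continuous_snd).continuousAt

open Classical in
/-- The extension by the identity of a self-map of the half space given in the chart. -/
noncomputable def halfExtend (N : ℝ × ℝ × E → ℝ × ℝ × E) (p : E × ℂ) : E × ℂ :=
  if 0 < p.2.re then halfChart ℓ (N (halfChartInv ℓ p)) else p

lemma tendsto_inv_re {p : E × ℂ} (h : p.2.re = 0) :
    Tendsto (fun q : E × ℂ => q.2.re⁻¹) (𝓝 p ⊓ 𝓟 {q | 0 < q.2.re}) atTop := by
  refine tendsto_inv_nhdsGT_zero.comp (tendsto_nhdsWithin_iff.2 ⟨?_, ?_⟩)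
  · have := (Complex.continuous_re.comp (continuous_snd (X := E))).tendsto p
    simp only [Function.comp_def, h] at this
    exact this.mono_left inf_le_left
  · exact mem_inf_of_right (mem_principal_self _)

lemma tendsto_halfChart_of_arctan {l : Filter ℝ} {a : ℝ} (hl : Tendsto Real.arctan l (𝓝 a))
    (v : ℝ) (y : E) : Tendsto (halfChart ℓ) (l ×ˢ 𝓝 v ×ˢ 𝓝 y)
      (𝓝 (y, Complex.exp (((-ℓ v : ℝ) : ℂ) + ((a : ℝ) : ℂ) * Complex.I))) := by
  have hc : Continuous fun w : ℝ × ℝ × E =>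
      (w.2.2, Complex.exp (((-ℓ w.2.1 : ℝ) : ℂ) + ((w.1 : ℝ) : ℂ) * Complex.I)) := by
    have := ℓ.continuous
    fun_prop
  have := hc.tendsto (a, v, y)
  rw [nhds_prod_eq, nhds_prod_eq] at this
  exact this.comp ((hl.comp tendsto_fst).prodMk tendsto_snd)

lemma continuous_halfExtend {N : ℝ × ℝ × E → ℝ × ℝ × E} (hN : Continuous N) (h : FixesEnds N) :
    Continuous (halfExtend ℓ N) := by
  classical
  refine continuous_iff_continuousAt.2 fun p => ?_
  have hre : Continuous fun q : E × ℂ => q.2.re := by fun_prop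
  rcases lt_trichotomy p.2.re 0 with hp | hp | hp
  · refine continuousAt_id.congr ?_
    filter_upwards [hre.continuousAt.eventually (gt_mem_nhds hp)] with q hq
    exact (if_neg (not_lt.2 hq.le)).symm
  · have hpp : halfExtend ℓ N p = p := if_neg hp.not_gt
    rw [ContinuousAt, hpp]
    refine Tendsto.if ?_ (tendsto_id.mono_left inf_le_left)
    have hy : Tendsto (fun q : E × ℂ => q.1) (𝓝 p ⊓ 𝓟 {q | 0 < q.2.re}) (𝓝 p.1) :=
      (continuous_fst.tendsto p).mono_left inf_le_left
    have him : Tendsto (fun q : E × ℂ => q.2.im) (𝓝 p ⊓ 𝓟 {q | 0 < q.2.re}) (𝓝 p.2.im) :=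
      ((Complex.continuous_im.comp continuous_snd).tendsto p).mono_left inf_le_left
    by_cases h0 : p.2 = 0
    · have hc : Tendsto (halfChart ℓ) ((⊤ : Filter ℝ) ×ˢ atTop ×ˢ 𝓝 p.1) (𝓝 p) := by
        have hp' : p = (p.1, 0) := Prod.ext rfl h0
        rw [hp', nhds_prod_eq]
        refine (tendsto_snd.comp tendsto_snd).prodMk (tendsto_zero_iff_norm_tendsto_zero.2 ?_)
        simp only [Complex.norm_exp, Complex.add_re, Complex.ofReal_re, Complex.mul_re,
          Complex.I_re, Complex.ofReal_im, Complex.I_im, mul_zero, zero_mul, sub_zero, add_zero]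
        exact Real.tendsto_exp_atBot.comp (tendsto_neg_atTop_atBot.comp
          (ℓ.tendsto_atTop.comp (tendsto_fst.comp tendsto_snd)))
      refine hc.comp ((h.2.2 p.1).comp (tendsto_top.prodMk (Tendsto.prodMk ?_ hy)))
      refine (tendsto_depth_atTop ℓ h0).mono_left (inf_le_inf_left _ (principal_mono.2 ?_))
      intro q hq h'
      simp [h'] at hq
    · have hv := (tendsto_depth_nhds ℓ h0).mono_left
        (inf_le_left : 𝓝 p ⊓ 𝓟 {q : E × ℂ | 0 < q.2.re} ≤ 𝓝 p)
      have hlog : (p.1, Complex.exp (Complex.log p.2)) = p := Prod.ext rfl (Complex.exp_log h0)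
      have him0 : p.2.im ≠ 0 := fun h' => h0 (Complex.ext hp h')
      rcases him0.lt_or_gt with hi | hi
      · have hc := tendsto_halfChart_of_arctan ℓ (Real.tendsto_arctan_atBot.mono_right
          nhdsWithin_le_nhds) (ℓ.symm (-Real.log ‖p.2‖)) p.1
        have : Complex.arg p.2 = -(Real.pi / 2) := Complex.arg_eq_neg_pi_div_two_iff.2 ⟨hp, hi⟩
        rw [← this, OrderIso.apply_symm_apply, neg_neg] at hc
        change Tendsto _ _ (𝓝 (p.1, Complex.exp (Complex.log p.2))) at hc
        rw [hlog] at hc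
        exact hc.comp ((h.2.1 _ p.1).comp (Tendsto.prodMk
          (him.neg_mul_atTop hi (tendsto_inv_re hp)) (hv.prodMk hy)))
      · have hc := tendsto_halfChart_of_arctan ℓ (Real.tendsto_arctan_atTop.mono_right
          nhdsWithin_le_nhds) (ℓ.symm (-Real.log ‖p.2‖)) p.1
        have : Complex.arg p.2 = Real.pi / 2 := Complex.arg_eq_pi_div_two_iff.2 ⟨hp, hi⟩
        rw [← this, OrderIso.apply_symm_apply, neg_neg] at hc
        change Tendsto _ _ (𝓝 (p.1, Complex.exp (Complex.log p.2))) at hc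
        rw [hlog] at hc
        exact hc.comp ((h.1 _ p.1).comp (Tendsto.prodMk
          (him.pos_mul_atTop hi (tendsto_inv_re hp)) (hv.prodMk hy)))
  · refine (((continuous_halfChart ℓ).comp hN).continuousAt.comp
      (continuousAt_halfChartInv ℓ hp)).congr ?_
    filter_upwards [hre.continuousAt.eventually (lt_mem_nhds hp)] with q hq
    exact (if_pos hq).symm

lemma halfExtend_halfExtend {M N : ℝ × ℝ × E → ℝ × ℝ × E} (h : ∀ x, M (N x) = x) (p : E × ℂ) :
    halfExtend ℓ M (halfExtend ℓ N p) = p := by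
  by_cases hp : 0 < p.2.re
  · simp [halfExtend, hp, re_halfChart_pos, halfChartInv_halfChart, h, halfChart_halfChartInv]
  · simp [halfExtend, hp]

theorem exists_homeomorph_halfExtend (N : (ℝ × ℝ × E) ≃ₜ (ℝ × ℝ × E)) (h : FixesEnds N)
    (h' : FixesEnds N.symm) : ∃ Ψ : (E × ℂ) ≃ₜ (E × ℂ),
      (∀ p, p.2.re ≤ 0 → Ψ p = p) ∧ ∀ p, 0 < p.2.re → 0 < (Ψ p).2.re ∧
        ((Ψ p).2.im = 0 ↔ (N (p.2.im / p.2.re, ℓ.symm (-Real.log ‖p.2‖), p.1)).1 = 0) := by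
  refine ⟨{ toFun := halfExtend ℓ N
            invFun := halfExtend ℓ N.symm
            left_inv := halfExtend_halfExtend ℓ N.symm_apply_apply
            right_inv := halfExtend_halfExtend ℓ N.apply_symm_apply
            continuous_toFun := continuous_halfExtend ℓ N.continuous h
            continuous_invFun := continuous_halfExtend ℓ N.symm.continuous h' },
    fun p hp => if_neg (not_lt.2 hp), fun p hp => ?_⟩
  change 0 < (halfExtend ℓ N p).2.re ∧ ((halfExtend ℓ N p).2.im = 0 ↔ _)
  rw [halfExtend, if_pos hp]
  exact ⟨re_halfChart_pos ℓ _, im_halfChart_eq_zero_iff ℓ _⟩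

end CoverMaps
section Scale

open Filter Topology

lemma exists_orderIso_interpolating (a : ℕ → ℝ) (ha : ∀ k, a k + 1 ≤ a (k + 1)) :
    ∃ ℓ : ℝ ≃o ℝ, ∀ k : ℕ, ℓ k = a k := by
  let g : ℕ → ℝ → ℝ := fun k u => (a (k + 1) - a k - 1) * max 0 (min 1 (u - k))
  have hcoef : ∀ k, 0 ≤ a (k + 1) - a k - 1 := fun k => by linarith [ha k]
  have hg0 : ∀ k u, 0 ≤ g k u := fun k u => mul_nonneg (hcoef k) (le_max_left _ _)
  have hgz : ∀ (k : ℕ) (u : ℝ), u ≤ (k : ℝ) → g k u = 0 := fun k u h => by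
    have : max 0 (min 1 (u - k)) = 0 := max_eq_left ((min_le_right _ _).trans (by linarith))
    simp only [g, this, mul_zero]
  have hg1 : ∀ (k : ℕ) (u : ℝ), (k : ℝ) + 1 ≤ u → g k u = a (k + 1) - a k - 1 := fun k u h => by
    have : min 1 (u - k) = 1 := min_eq_left (by linarith)
    simp [g, this]
  have hmono : ∀ k, Monotone (g k) := fun k u w h =>
    mul_le_mul_of_nonneg_left (max_le_max le_rfl (min_le_min le_rfl (by linarith))) (hcoef k)
  have hsupp : ∀ (u : ℝ) (M : ℕ), u ≤ M →
      (Function.support fun k => g k u) ⊆ (Finset.range M : Finset ℕ) := by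
    intro u M h k hk
    by_contra hkM
    have : M ≤ k := by simpa using hkM
    exact hk (hgz k u (h.trans (by exact_mod_cast this)))
  have hsum : ∀ (u : ℝ) (M : ℕ), u ≤ M → ∑ᶠ k, g k u = ∑ k ∈ Finset.range M, g k u :=
    fun u M h => finsum_eq_sum_of_support_subset _ (hsupp u M h)
  let f : ℝ → ℝ := fun u => a 0 + u + ∑ᶠ k, g k u
  have hf : Continuous f := by
    refine (continuous_const.add continuous_id).add (continuous_finsum (fun k => ?_) fun u => ?_)
    · simp only [g]; fun_prop
    · obtain ⟨M, hM⟩ := exists_nat_gt u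
      refine ⟨Iio (M : ℝ), Iio_mem_nhds hM, (Finset.range M).finite_toSet.subset ?_⟩
      rintro k ⟨w, hw, hwM⟩
      exact hsupp w M (le_of_lt hwM) hw
  have hfm : StrictMono f := by
    intro u w h
    obtain ⟨M, hM⟩ := exists_nat_gt w
    simp only [f]
    rw [hsum u M (h.le.trans hM.le), hsum w M hM.le]
    have := Finset.sum_le_sum fun k (_ : k ∈ Finset.range M) => hmono k h.le
    linarith
  have hfs : Function.Surjective f := by
    refine hf.surjective ?_ ?_
    · refine tendsto_atTop_mono (fun u => ?_) (tendsto_atTop_add_const_left _ (a 0) tendsto_id)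
      have : 0 ≤ ∑ᶠ k, g k u := finsum_nonneg fun k => hg0 k u
      simp only [f, id]; linarith
    · refine (tendsto_atBot_add_const_left _ (a 0) tendsto_id).congr' ?_
      filter_upwards [eventually_le_atBot 0] with u hu
      simp [f, hsum u 0 (by simpa using hu)]
  refine ⟨hfm.orderIsoOfSurjective f hfs, fun k => ?_⟩
  change f k = a k
  simp only [f]
  rw [hsum k k le_rfl, Finset.sum_congr rfl fun i hi => hg1 i k (by
    exact_mod_cast Finset.mem_range.1 hi), Finset.sum_sub_distrib, Finset.sum_range_sub]
  simp

lemma exists_orderIso_growth (T : ℕ → ℝ → ℝ) :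
    ∃ ℓ : ℝ ≃o ℝ, ∀ k : ℕ, T k (ℓ k) ≤ ℓ (k + 1) := by
  let a : ℕ → ℝ := Nat.rec 0 fun k x => max (x + 1) (T k x)
  have ha : ∀ k, a (k + 1) = max (a k + 1) (T k (a k)) := fun k => rfl
  obtain ⟨ℓ, hℓ⟩ := exists_orderIso_interpolating a fun k => by rw [ha]; exact le_max_left _ _
  refine ⟨ℓ, fun k => ?_⟩
  have := hℓ (k + 1)
  push_cast at this
  rw [this, hℓ, ha]
  exact le_max_right _ _

variable {E : Type*} [NormedAddCommGroup E]

lemma exists_forall_near_axis {F : E × ℂ → E × ℂ} (hF : Continuous F)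
    (h0 : ∀ y, F (y, 0) = (y, 0)) {K : Set E} (hK : IsCompact K) {ε : ℝ} (hε : 0 < ε) :
    ∃ δ > 0, ∀ y ∈ K, ∀ z : ℂ, ‖z‖ ≤ δ → ‖(F (y, z)).2‖ < ε ∧ ‖(F (y, z)).1 - y‖ < ε := by
  have hU : IsOpen {p : E × ℂ | ‖(F p).2‖ < ε ∧ ‖(F p).1 - p.1‖ < ε} :=
    IsOpen.and (isOpen_lt (by fun_prop) continuous_const) (isOpen_lt (by fun_prop) continuous_const)
  obtain ⟨u, v, hu, hv, hKu, h0v, huv⟩ := generalized_tube_lemma hK (isCompact_singleton (x := (0 : ℂ)))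
    hU (by
      rintro ⟨y, z⟩ ⟨-, hz⟩
      rw [mem_singleton_iff] at hz
      simp only at hz
      subst hz
      simp [h0, hε])
  obtain ⟨δ, hδ, hball⟩ := Metric.isOpen_iff.1 hv 0 (h0v rfl)
  refine ⟨δ / 2, by positivity, fun y hy z hz => huv ⟨hKu hy, hball ?_⟩⟩
  rw [mem_ball_zero_iff]; linarith

lemma exists_scale [ProperSpace E] {F : E × ℂ → E × ℂ} (hF : Continuous F)
    (h0 : ∀ y, F (y, 0) = (y, 0)) (k : ℕ) (t : ℝ) :
    ∃ s : ℝ, ∀ y : E, ‖y‖ ≤ k → ∀ z : ℂ, ‖z‖ ≤ Real.exp (-s) →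
      ‖(F (y, z)).2‖ ≤ Real.exp (-t) ∧ ‖(F (y, z)).1 - y‖ ≤ 1 / (k + 1) := by
  obtain ⟨δ, hδ, h⟩ := exists_forall_near_axis hF h0
    (isCompact_closedBall (0 : E) k) (ε := min (Real.exp (-t)) (1 / (k + 1))) (by positivity)
  refine ⟨-Real.log δ, fun y hy z hz => ?_⟩
  rw [neg_neg, Real.exp_log hδ] at hz
  obtain ⟨h1, h2⟩ := h y (by simpa using hy) z hz
  exact ⟨h1.le.trans (min_le_left _ _), h2.le.trans (min_le_right _ _)⟩

lemma exists_common_scale [ProperSpace E] {F G : E × ℂ → E × ℂ} (hF : Continuous F)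
    (hF0 : ∀ y, F (y, 0) = (y, 0)) (hG : Continuous G) (hG0 : ∀ y, G (y, 0) = (y, 0)) :
    ∃ ℓ : ℝ ≃o ℝ, ∀ H, H = F ∨ H = G → ∀ (k : ℕ) (y : E), ‖y‖ ≤ k → ∀ z : ℂ,
      ‖z‖ ≤ Real.exp (-ℓ (k + 1)) →
        ‖(H (y, z)).2‖ ≤ Real.exp (-ℓ k) ∧ ‖(H (y, z)).1 - y‖ ≤ 1 / (k + 1) := by
  choose S hS using exists_scale hF hF0
  choose T hT using exists_scale hG hG0
  obtain ⟨ℓ, hℓ⟩ := exists_orderIso_growth fun k t => max (S k t) (T k t)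
  refine ⟨ℓ, ?_⟩
  rintro H (rfl | rfl) k y hy z hz
  · exact hS k _ y hy z (hz.trans (Real.exp_le_exp.2
      (neg_le_neg ((le_max_left _ _).trans (hℓ k)))))
  · exact hT k _ y hy z (hz.trans (Real.exp_le_exp.2
      (neg_le_neg ((le_max_right _ _).trans (hℓ k)))))

end Scale

section Lift

open Filter Topology

set_option linter.unusedSectionVars false

variable {E : Type*} [NormedAddCommGroup E]

/-- Logarithmic polar coordinates on the complement of the axis `E × {0}`. -/
noncomputable def polarCover (ℓ : ℝ ≃o ℝ) (x : ℝ × ℝ × E) : E × ℂ :=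
  (x.2.2, Complex.exp (((-ℓ x.2.1 : ℝ) : ℂ) + (x.1 : ℂ) * Complex.I))

/-- The lift to polar coordinates of a map `F` that turns the angle by `D`. -/
noncomputable def polarLift (ℓ : ℝ ≃o ℝ) (F : E × ℂ → E × ℂ) (D : E × ℂ → ℝ) (x : ℝ × ℝ × E) :
    ℝ × ℝ × E :=
  (x.1 + D (polarCover ℓ x), ℓ.symm (-Real.log ‖(F (polarCover ℓ x)).2‖), (F (polarCover ℓ x)).1)

variable (ℓ : ℝ ≃o ℝ)

lemma continuous_polarCover : Continuous (polarCover ℓ : ℝ × ℝ × E → E × ℂ) := by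
  have := ℓ.continuous
  unfold polarCover
  fun_prop

lemma polarCover_ne_zero (x : ℝ × ℝ × E) : (polarCover ℓ x).2 ≠ 0 := Complex.exp_ne_zero _

lemma norm_polarCover (x : ℝ × ℝ × E) : ‖(polarCover ℓ x).2‖ = Real.exp (-ℓ x.2.1) := by
  simp only [polarCover, Complex.norm_exp, Complex.add_re, Complex.ofReal_re, Complex.mul_re,
    Complex.I_re, Complex.ofReal_im, Complex.I_im, mul_zero, zero_mul, sub_zero, add_zero]

lemma depth_polarCover (x : ℝ × ℝ × E) : ℓ.symm (-Real.log ‖(polarCover ℓ x).2‖) = x.2.1 := by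
  rw [norm_polarCover, Real.log_exp, neg_neg, OrderIso.symm_apply_apply]

lemma polarCover_eq (x : ℝ × ℝ × E) :
    (polarCover ℓ x).2 = (‖(polarCover ℓ x).2‖ : ℂ) * Complex.exp ((x.1 : ℂ) * Complex.I) := by
  rw [norm_polarCover, Complex.ofReal_exp, ← Complex.exp_add]
  rfl

lemma arg_polarCover {x : ℝ × ℝ × E} (h : x.1 ∈ Ioc (-Real.pi) Real.pi) :
    Complex.arg (polarCover ℓ x).2 = x.1 := by
  rw [polarCover_eq, Complex.arg_real_mul _ (norm_pos_iff.2 (polarCover_ne_zero ℓ x)),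
    Complex.arg_exp_mul_I, toIocMod_eq_self]
  rwa [show -Real.pi + 2 * Real.pi = Real.pi by ring]

/-- `F` turns the angle by `D`. -/
def TurnsBy (F : E × ℂ → E × ℂ) (D : E × ℂ → ℝ) : Prop :=
  ∀ p, p.2 ≠ 0 → (F p).2 ≠ 0 ∧
    (F p).2 * ‖p.2‖ = ‖(F p).2‖ * p.2 * Complex.exp ((D p : ℂ) * Complex.I)

lemma TurnsBy.polarCover_polarLift {F : E × ℂ → E × ℂ} {D : E × ℂ → ℝ} (h : TurnsBy F D)
    (x : ℝ × ℝ × E) : polarCover ℓ (polarLift ℓ F D x) = F (polarCover ℓ x) := by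
  obtain ⟨h1, h2⟩ := h _ (polarCover_ne_zero ℓ x)
  refine Prod.ext rfl ?_
  have hn : (‖(polarCover ℓ x).2‖ : ℂ) ≠ 0 := by
    simpa using polarCover_ne_zero ℓ x
  have h3 : ‖(polarCover ℓ (polarLift ℓ F D x)).2‖ = ‖(F (polarCover ℓ x)).2‖ := by
    rw [norm_polarCover]
    simp only [polarLift, OrderIso.apply_symm_apply, neg_neg]
    exact Real.exp_log (norm_pos_iff.2 h1)
  rw [polarCover_eq, h3]
  have h4 : ((polarLift ℓ F D x).1 : ℂ) = x.1 + D (polarCover ℓ x) := by simp [polarLift]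
  rw [h4, add_mul, Complex.exp_add]
  apply mul_right_cancel₀ hn
  rw [h2]
  linear_combination (-‖(F (polarCover ℓ x)).2‖ * Complex.exp ((D (polarCover ℓ x) : ℂ) *
    Complex.I)) * polarCover_eq ℓ x

lemma TurnsBy.symm {φ : (E × ℂ) ≃ₜ (E × ℂ)} {D : E × ℂ → ℝ} (h : TurnsBy φ D)
    (h0 : ∀ p, (φ p).2 ≠ 0 → p.2 ≠ 0) : TurnsBy φ.symm fun q => -D (φ.symm q) := by
  intro q hq
  have hq' : (φ.symm q).2 ≠ 0 := h0 _ (by simpa using hq)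
  refine ⟨hq', ?_⟩
  have := (h _ hq').2
  rw [Homeomorph.apply_symm_apply] at this
  have he : Complex.exp ((D (φ.symm q) : ℂ) * Complex.I) *
      Complex.exp (((-D (φ.symm q) : ℝ) : ℂ) * Complex.I) = 1 := by
    rw [← Complex.exp_add, Complex.ofReal_neg, neg_mul, add_neg_cancel, Complex.exp_zero]
  linear_combination (-Complex.exp (((-D (φ.symm q) : ℝ) : ℂ) * Complex.I)) * this -
    (φ.symm q).2 * ‖q.2‖ * he

lemma continuous_polarLift {F : E × ℂ → E × ℂ} {D : E × ℂ → ℝ} (hF : Continuous F)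
    (hF0 : ∀ p, p.2 ≠ 0 → (F p).2 ≠ 0) (hD : ContinuousOn D {p | p.2 ≠ 0}) :
    Continuous (polarLift ℓ F D) := by
  have hP := continuous_polarCover (E := E) ℓ
  refine Continuous.prodMk (continuous_fst.add ?_) (Continuous.prodMk ?_ (by fun_prop))
  · exact hD.comp_continuous hP (polarCover_ne_zero ℓ)
  · refine ℓ.symm.continuous.comp (Continuous.neg (Continuous.log (by fun_prop) fun x => ?_))
    exact norm_ne_zero_iff.2 (hF0 _ (polarCover_ne_zero ℓ x))

/-- The depth scale `ℓ` dominates the displacement of `F` near the axis. -/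
def Dominates (F : E × ℂ → E × ℂ) : Prop :=
  ∀ (k : ℕ) (y : E), ‖y‖ ≤ k → ∀ z : ℂ, ‖z‖ ≤ Real.exp (-ℓ (k + 1)) →
    ‖(F (y, z)).2‖ ≤ Real.exp (-ℓ k) ∧ ‖(F (y, z)).1 - y‖ ≤ 1 / (k + 1)

lemma Dominates.polarLift_le {F : E × ℂ → E × ℂ} {D : E × ℂ → ℝ} (h : Dominates ℓ F)
    (hF0 : ∀ p, p.2 ≠ 0 → (F p).2 ≠ 0) {x : ℝ × ℝ × E} (hx : ‖x.2.2‖ + 2 ≤ x.2.1) :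
    x.2.1 - 2 ≤ (polarLift ℓ F D x).2.1 ∧
      ‖(polarLift ℓ F D x).2.2 - x.2.2‖ ≤ 1 / (x.2.1 - 1) := by
  have hu : 0 ≤ x.2.1 := by linarith [norm_nonneg x.2.2]
  have h1 := Nat.floor_le hu
  have h2 := Nat.lt_floor_add_one x.2.1
  have h3 : 1 ≤ ⌊x.2.1⌋₊ := Nat.le_floor (by push_cast; linarith [norm_nonneg x.2.2])
  obtain ⟨k, hk⟩ := Nat.exists_eq_add_of_le' h3
  rw [hk] at h1 h2
  push_cast at h1 h2
  obtain ⟨h4, h5⟩ := h k x.2.2 (by linarith) (polarCover ℓ x).2 (by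
    rw [norm_polarCover]
    exact Real.exp_le_exp.2 (neg_le_neg (ℓ.monotone h1)))
  constructor
  · have h6 : (k : ℝ) ≤ (polarLift ℓ F D x).2.1 := by
      simp only [polarLift]
      rw [OrderIso.le_symm_apply]
      have := Real.log_le_log (norm_pos_iff.2 (hF0 _ (polarCover_ne_zero ℓ x))) h4
      rw [Real.log_exp] at this
      linarith
    linarith
  · refine le_trans h5 (one_div_le_one_div_of_le ?_ ?_) <;> linarith [norm_nonneg x.2.2]

lemma nearAxis_polarLift {F G : E × ℂ → E × ℂ} {D : E × ℂ → ℝ} (hF : Dominates ℓ F)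
    (hG : Dominates ℓ G) (hF0 : ∀ p, p.2 ≠ 0 → (F p).2 ≠ 0) (hG0 : ∀ p, p.2 ≠ 0 → (G p).2 ≠ 0)
    (hGF : ∀ p, G (F p) = p) (hD : TurnsBy F D) {C : ℝ} (hC : ∀ p, |D p| ≤ C) :
    NearAxis (polarLift ℓ F D) C := by
  have key : ∀ y : E, ∀ᶠ x in (⊤ : Filter ℝ) ×ˢ (atTop : Filter ℝ) ×ˢ 𝓝 y,
      ‖x.2.2‖ + 5 ≤ x.2.1 := by
    intro y
    have e2 : Tendsto (fun x : ℝ × ℝ × E => x.2.1) ((⊤ : Filter ℝ) ×ˢ atTop ×ˢ 𝓝 y) atTop :=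
      tendsto_fst.comp tendsto_snd
    have e3 : Tendsto (fun x : ℝ × ℝ × E => x.2.2) ((⊤ : Filter ℝ) ×ˢ atTop ×ˢ 𝓝 y) (𝓝 y) :=
      tendsto_snd.comp tendsto_snd
    filter_upwards [e2.eventually_ge_atTop (‖y‖ + 6),
      e3.norm.eventually (gt_mem_nhds (lt_add_one ‖y‖))] with x h1 h2
    linarith
  refine ⟨fun x => by simpa [polarLift] using hC _, fun y => ?_, fun y => ?_⟩
  · filter_upwards [key y] with x hx
    obtain ⟨h1, h2⟩ := hF.polarLift_le ℓ (D := D) hF0 (by linarith : ‖x.2.2‖ + 2 ≤ x.2.1)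
    have h3 : 1 / (x.2.1 - 1) ≤ 1 := by
      rw [div_le_one] <;> linarith [norm_nonneg x.2.2]
    have h4 : ‖(polarLift ℓ F D x).2.2‖ ≤ ‖x.2.2‖ + 1 := by
      have := norm_add_le ((polarLift ℓ F D x).2.2 - x.2.2) x.2.2
      rw [sub_add_cancel] at this
      linarith
    have h5 := (hG.polarLift_le ℓ (D := D) hG0
      (by linarith : ‖(polarLift ℓ F D x).2.2‖ + 2 ≤ (polarLift ℓ F D x).2.1)).1
    have h6 : (polarLift ℓ G D (polarLift ℓ F D x)).2.1 = x.2.1 := by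
      rw [polarLift, hD.polarCover_polarLift, hGF]
      exact depth_polarCover ℓ x
    rw [h6] at h5
    rw [abs_le]
    constructor <;> linarith
  · have e2 : Tendsto (fun x : ℝ × ℝ × E => x.2.1) ((⊤ : Filter ℝ) ×ˢ atTop ×ˢ 𝓝 y) atTop :=
      tendsto_fst.comp tendsto_snd
    have e3 : Tendsto (fun x : ℝ × ℝ × E => x.2.2) ((⊤ : Filter ℝ) ×ˢ atTop ×ˢ 𝓝 y) (𝓝 y) :=
      tendsto_snd.comp tendsto_snd
    have h0 : Tendsto (fun x : ℝ × ℝ × E => (polarLift ℓ F D x).2.2 - x.2.2)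
        ((⊤ : Filter ℝ) ×ˢ atTop ×ˢ 𝓝 y) (𝓝 0) := by
      refine squeeze_zero_norm' ((key y).mono fun x hx =>
        (hF.polarLift_le ℓ (D := D) hF0 (by linarith : ‖x.2.2‖ + 2 ≤ x.2.1)).2) ?_
      exact tendsto_const_nhds.div_atTop (tendsto_atTop_add_const_right _ (-1) e2)
    have := h0.add e3
    simp only [sub_add_cancel, zero_add] at this
    exact this

end Lift

section HalfSpace

open Filter Topology

set_option linter.unusedSectionVars false

variable {E : Type*} [NormedAddCommGroup E]

/-- `φ` fixes the axis, maps the half planes `±i ℝ₊` to the corresponding sides of `ℝ`, and the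
preimages of the half planes `±ℝ₊` lie on the corresponding sides of `i ℝ`. -/
structure Aligned (φ : (E × ℂ) ≃ₜ (E × ℂ)) : Prop where
  fix : ∀ y, φ (y, 0) = (y, 0)
  im_pos : ∀ p, p.2.re = 0 → 0 < p.2.im → 0 < (φ p).2.im
  im_neg : ∀ p, p.2.re = 0 → p.2.im < 0 → (φ p).2.im < 0
  re_pos : ∀ p, (φ p).2.im = 0 → 0 < (φ p).2.re → 0 < p.2.re
  re_neg : ∀ p, (φ p).2.im = 0 → (φ p).2.re < 0 → p.2.re < 0

open Classical in
/-- The angle by which `F` turns. -/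
noncomputable def turnAngle (F : E × ℂ → E × ℂ) (p : E × ℂ) : ℝ :=
  if 0 ≤ p.2.re then Complex.arg (F p).2 - Complex.arg p.2
  else Complex.arg (-(F p).2) - Complex.arg (-p.2)

variable {φ : (E × ℂ) ≃ₜ (E × ℂ)}

lemma Aligned.symm_fix (h : Aligned φ) (y : E) : φ.symm (y, 0) = (y, 0) := by
  rw [Homeomorph.symm_apply_eq, h.fix]

lemma Aligned.ne_zero (h : Aligned φ) {p : E × ℂ} (hp : p.2 ≠ 0) : (φ p).2 ≠ 0 := by
  intro h0
  have : φ p = φ ((φ p).1, 0) := by rw [h.fix]; exact Prod.ext rfl h0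
  exact hp (congrArg Prod.snd (φ.injective this))

lemma Aligned.ne_zero_of (h : Aligned φ) {p : E × ℂ} (hp : (φ p).2 ≠ 0) : p.2 ≠ 0 := by
  intro h0
  have : p = (p.1, 0) := Prod.ext rfl h0
  rw [this, h.fix] at hp
  exact hp rfl

lemma Aligned.mem_slitPlane (h : Aligned φ) {p : E × ℂ} (hp : p.2 ≠ 0) (hre : 0 ≤ p.2.re) :
    (φ p).2 ∈ Complex.slitPlane := by
  rw [Complex.mem_slitPlane_iff]
  by_contra! hc
  have hlt : (φ p).2.re < 0 := lt_of_le_of_ne hc.1 fun h0 => h.ne_zero hp (Complex.ext h0 hc.2)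
  exact (h.re_neg p hc.2 hlt).not_ge hre

lemma Aligned.neg_mem_slitPlane (h : Aligned φ) {p : E × ℂ} (hp : p.2 ≠ 0) (hre : p.2.re ≤ 0) :
    -(φ p).2 ∈ Complex.slitPlane := by
  rw [Complex.mem_slitPlane_iff]
  by_contra! hc
  simp only [Complex.neg_re, Complex.neg_im, neg_eq_zero, Left.neg_nonpos_iff] at hc
  have hlt : 0 < (φ p).2.re :=
    lt_of_le_of_ne hc.1 fun h0 => h.ne_zero hp (Complex.ext h0.symm hc.2)
  exact (h.re_pos p hc.2 hlt).not_ge hre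

lemma mem_slitPlane_of_re_nonneg {z : ℂ} (hz : z ≠ 0) (hre : 0 ≤ z.re) :
    z ∈ Complex.slitPlane := by
  rw [Complex.mem_slitPlane_iff]
  by_contra! hc
  exact hz (Complex.ext (le_antisymm hc.1 hre) hc.2)

lemma Aligned.arg_sub_arg_eq (h : Aligned φ) {p : E × ℂ} (hp : p.2 ≠ 0) (hre : p.2.re = 0) :
    Complex.arg (φ p).2 - Complex.arg p.2 = Complex.arg (-(φ p).2) - Complex.arg (-p.2) := by
  have him : p.2.im ≠ 0 := fun h0 => hp (Complex.ext hre h0)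
  rcases him.lt_or_gt with hi | hi
  · rw [Complex.arg_neg_eq_arg_add_pi_of_im_neg hi,
      Complex.arg_neg_eq_arg_add_pi_of_im_neg (h.im_neg p hre hi)]
    ring
  · rw [Complex.arg_neg_eq_arg_sub_pi_of_im_pos hi,
      Complex.arg_neg_eq_arg_sub_pi_of_im_pos (h.im_pos p hre hi)]
    ring

lemma Aligned.continuousOn_turnAngle (h : Aligned φ) :
    ContinuousOn (turnAngle φ) {p | p.2 ≠ 0} := by
  classical
  have hc2 : Continuous fun q : E × ℂ => (φ q).2 := continuous_snd.comp φ.continuous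
  have hre : Continuous fun q : E × ℂ => q.2.re := by fun_prop
  have h1 : ∀ p : E × ℂ, p.2 ≠ 0 → 0 ≤ p.2.re →
      ContinuousAt (fun q : E × ℂ => Complex.arg (φ q).2 - Complex.arg q.2) p := fun p hp hr =>
    ((Complex.continuousAt_arg (h.mem_slitPlane hp hr)).comp
      (f := fun q : E × ℂ => (φ q).2) hc2.continuousAt).sub
    ((Complex.continuousAt_arg (mem_slitPlane_of_re_nonneg hp hr)).comp
      (f := fun q : E × ℂ => q.2) continuousAt_snd)
  have h2 : ∀ p : E × ℂ, p.2 ≠ 0 → p.2.re ≤ 0 →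
      ContinuousAt (fun q : E × ℂ => Complex.arg (-(φ q).2) - Complex.arg (-q.2)) p :=
    fun p hp hr =>
    ((Complex.continuousAt_arg (h.neg_mem_slitPlane hp hr)).comp
      (f := fun q : E × ℂ => -(φ q).2) hc2.neg.continuousAt).sub
    ((Complex.continuousAt_arg (mem_slitPlane_of_re_nonneg (neg_ne_zero.2 hp)
      (by simpa using hr))).comp (f := fun q : E × ℂ => -q.2) continuousAt_snd.neg)
  intro p hp
  refine ContinuousAt.continuousWithinAt ?_
  rcases lt_trichotomy p.2.re 0 with hr | hr | hr
  · refine (h2 p hp hr.le).congr ?_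
    filter_upwards [hre.continuousAt.eventually (gt_mem_nhds hr)] with q hq
    exact (if_neg (not_le.2 hq)).symm
  · have hpp : turnAngle φ p = Complex.arg (φ p).2 - Complex.arg p.2 := if_pos hr.ge
    have t1 := h1 p hp hr.ge
    have t2 := h2 p hp hr.le
    rw [ContinuousAt] at t1 t2 ⊢
    rw [← h.arg_sub_arg_eq hp hr] at t2
    rw [hpp]
    exact Tendsto.if (t1.mono_left inf_le_left) (t2.mono_left inf_le_left)
  · refine (h1 p hp hr.le).congr ?_
    filter_upwards [hre.continuousAt.eventually (lt_mem_nhds hr)] with q hq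
    exact (if_pos hq.le).symm

lemma abs_turnAngle_le (F : E × ℂ → E × ℂ) (p : E × ℂ) : |turnAngle F p| ≤ 2 * Real.pi := by
  have key : ∀ z w : ℂ, |Complex.arg z - Complex.arg w| ≤ 2 * Real.pi := fun z w => by
    refine (abs_sub _ _).trans ?_
    linarith [Complex.abs_arg_le_pi z, Complex.abs_arg_le_pi w]
  rw [turnAngle]
  split_ifs <;> exact key _ _

lemma mul_norm_eq_of_arg_sub (z w : ℂ) :
    w * ‖z‖ = ‖w‖ * z * Complex.exp (((Complex.arg w - Complex.arg z : ℝ) : ℂ) * Complex.I) := by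
  have hz := Complex.norm_mul_exp_arg_mul_I z
  have hw := Complex.norm_mul_exp_arg_mul_I w
  have he : Complex.exp ((Complex.arg z : ℂ) * Complex.I) *
      Complex.exp (((Complex.arg w - Complex.arg z : ℝ) : ℂ) * Complex.I) =
      Complex.exp ((Complex.arg w : ℂ) * Complex.I) := by
    rw [← Complex.exp_add]
    congr 1
    push_cast
    ring
  linear_combination (-‖z‖ : ℂ) * hw + ‖w‖ *
    Complex.exp (((Complex.arg w - Complex.arg z : ℝ) : ℂ) * Complex.I) * hz - ‖w‖ * ‖z‖ * he

lemma Aligned.turnsBy (h : Aligned φ) : TurnsBy φ (turnAngle φ) := by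
  intro p hp
  refine ⟨h.ne_zero hp, ?_⟩
  by_cases hre : 0 ≤ p.2.re
  · rw [turnAngle, if_pos hre]
    exact mul_norm_eq_of_arg_sub _ _
  · rw [turnAngle, if_neg hre]
    have := mul_norm_eq_of_arg_sub (-p.2) (-(φ p).2)
    rw [norm_neg, norm_neg] at this
    linear_combination -this

variable (ℓ : ℝ ≃o ℝ)

/-- The lift of an aligned homeomorphism to polar coordinates. -/
noncomputable def Aligned.polarHomeomorph (h : Aligned φ) : (ℝ × ℝ × E) ≃ₜ (ℝ × ℝ × E) where
  toFun := polarLift ℓ φ (turnAngle φ)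
  invFun := polarLift ℓ φ.symm fun q => -turnAngle φ (φ.symm q)
  left_inv x := by
    conv_lhs => rw [polarLift, h.turnsBy.polarCover_polarLift]
    simp only [Homeomorph.symm_apply_apply, depth_polarCover]
    ext <;> simp [polarLift, polarCover]
  right_inv x := by
    conv_lhs => rw [polarLift, (h.turnsBy.symm fun p => h.ne_zero_of).polarCover_polarLift]
    simp only [Homeomorph.apply_symm_apply, depth_polarCover]
    ext <;> simp [polarLift, polarCover]
  continuous_toFun :=
    continuous_polarLift ℓ φ.continuous (fun _ => h.ne_zero) h.continuousOn_turnAngle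
  continuous_invFun := by
    refine continuous_polarLift ℓ φ.symm.continuous
      (fun p hp => h.ne_zero_of (by simpa using hp)) (ContinuousOn.neg ?_)
    exact h.continuousOn_turnAngle.comp φ.symm.continuous.continuousOn
      fun p hp => h.ne_zero_of (by simpa using hp)

lemma Aligned.polarHomeomorph_fst (h : Aligned φ) {x : ℝ × ℝ × E} (hx : |x.1| < Real.pi / 2) :
    (h.polarHomeomorph ℓ x).1 = Complex.arg (φ (polarCover ℓ x)).2 := by
  have hx' := abs_lt.1 hx
  have harg := arg_polarCover ℓ (x := x) ⟨by linarith [Real.pi_pos], by linarith [Real.pi_pos]⟩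
  have hre : 0 ≤ (polarCover ℓ x).2.re := by
    rw [← Complex.abs_arg_le_pi_div_two_iff, harg]
    exact hx.le
  change x.1 + turnAngle φ (polarCover ℓ x) = _
  rw [turnAngle, if_pos hre, harg]
  ring

lemma Aligned.abs_lt_of_polarHomeomorph_fst (h : Aligned φ) {x : ℝ × ℝ × E}
    (hx : (h.polarHomeomorph ℓ x).1 = 0) : |x.1| < Real.pi / 2 := by
  have h1 := polarCover_eq ℓ (h.polarHomeomorph ℓ x)
  have h2 : polarCover ℓ (h.polarHomeomorph ℓ x) = φ (polarCover ℓ x) :=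
    h.turnsBy.polarCover_polarLift ℓ x
  rw [h2, hx, Complex.ofReal_zero, zero_mul, Complex.exp_zero, mul_one] at h1
  have h3 : 0 < ‖(φ (polarCover ℓ x)).2‖ := norm_pos_iff.2 (h.ne_zero (polarCover_ne_zero ℓ x))
  have him : (φ (polarCover ℓ x)).2.im = 0 := by rw [h1]; simp
  have hre : 0 < (φ (polarCover ℓ x)).2.re := by rw [h1]; simpa using h3
  have h4 := h.re_pos _ him hre
  change x.1 + turnAngle φ (polarCover ℓ x) = 0 at hx
  rw [turnAngle, if_pos h4.le, h1, Complex.arg_ofReal_of_nonneg (norm_nonneg _), zero_sub] at hx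
  have : x.1 = Complex.arg (polarCover ℓ x).2 := by linarith
  rw [this]
  exact Complex.abs_arg_lt_pi_div_two_iff.2 (Or.inl h4)

lemma exists_local_tan_bound (Φ : (ℝ × ℝ × E) ≃ₜ (ℝ × ℝ × E))
    (h : ∀ x, (Φ x).1 = 0 → |x.1| < Real.pi / 2) (z₀ : ℝ × E) :
    ∃ c : ℝ, ∀ᶠ z in 𝓝 z₀, 0 ≤ c ∧ ∀ θ, (Φ (θ, z)).1 = 0 → |Real.tan θ| ≤ c := by
  have hcos : ∀ θ z, (Φ (θ, z)).1 = 0 → 0 < Real.cos θ := fun θ z hθ =>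
    Real.cos_pos_of_mem_Ioo (abs_lt.1 (h _ hθ))
  have hS : IsCompact (Icc (-(Real.pi / 2)) (Real.pi / 2) ∩ {θ | (Φ (θ, z₀)).1 = 0}) :=
    isCompact_Icc.inter_right (isClosed_eq (by fun_prop) continuous_const)
  obtain ⟨c, hc⟩ := hS.exists_bound_of_continuousOn (f := Real.tan) fun θ hθ =>
    (Real.continuousAt_tan.2 (hcos θ z₀ hθ.2).ne').continuousWithinAt
  have hU₁ : IsOpen {x : ℝ × ℝ × E | (Φ x).1 ≠ 0} :=
    isOpen_ne_fun (by fun_prop) continuous_const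
  have hU₂ : IsOpen {x : ℝ × ℝ × E | |Real.sin x.1| < (|c| + 1) * Real.cos x.1} :=
    isOpen_lt (by fun_prop) (by fun_prop)
  obtain ⟨u, v, hu, hv, hKu, h0v, huv⟩ := generalized_tube_lemma
    (isCompact_Icc (a := -(Real.pi / 2)) (b := Real.pi / 2)) (isCompact_singleton (x := z₀))
    (hU₁.union hU₂) (by
      rintro ⟨θ, z⟩ ⟨hθ, hz⟩
      rw [mem_singleton_iff] at hz
      simp only at hz
      subst hz
      by_cases h0 : (Φ (θ, z)).1 = 0
      · right
        have h1 := hcos θ z h0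
        have h2 := hc θ ⟨hθ, h0⟩
        rw [Real.norm_eq_abs, Real.tan_eq_sin_div_cos, abs_div, abs_of_pos h1,
          div_le_iff₀ h1] at h2
        change |Real.sin θ| < (|c| + 1) * Real.cos θ
        nlinarith [le_abs_self c]
      · exact Or.inl h0)
  refine ⟨|c| + 1, ?_⟩
  filter_upwards [hv.mem_nhds (h0v rfl)] with z hz
  refine ⟨by positivity, fun θ hθ => ?_⟩
  have h3 := abs_lt.1 (h _ hθ)
  rcases huv ⟨hKu ⟨h3.1.le, h3.2.le⟩, hz⟩ with h4 | h4
  · exact absurd hθ h4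
  · have h1 := hcos θ z hθ
    rw [Real.tan_eq_sin_div_cos, abs_div, abs_of_pos h1, div_le_iff₀ h1]
    exact h4.le

lemma exists_continuous_tan_bound (Φ : (ℝ × ℝ × E) ≃ₜ (ℝ × ℝ × E))
    (h : ∀ x, (Φ x).1 = 0 → |x.1| < Real.pi / 2) :
    ∃ b : ℝ × E → ℝ, Continuous b ∧ (∀ z, 0 ≤ b z) ∧
      ∀ θ z, (Φ (θ, z)).1 = 0 → |Real.tan θ| ≤ b z := by
  obtain ⟨b, hb⟩ := exists_continuous_forall_mem_convex_of_local_const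
    (t := fun z : ℝ × E => {c : ℝ | 0 ≤ c ∧ ∀ θ, (Φ (θ, z)).1 = 0 → |Real.tan θ| ≤ c})
    (fun z => OrdConnected.convex ⟨fun a ha c _ d hd =>
      ⟨ha.1.trans hd.1, fun θ hθ => (ha.2 θ hθ).trans hd.1⟩⟩)
    (exists_local_tan_bound Φ h)
  exact ⟨b, b.continuous, fun z => (hb z).1, fun θ z hθ => (hb z).2 θ hθ⟩

/-- The half-plane bundle over the positive reals pulled back by an aligned homeomorphism can be
straightened by a homeomorphism supported in the right half space. -/
theorem Aligned.exists_straightening [ProperSpace E] (h : Aligned φ) :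
    ∃ Ψ : (E × ℂ) ≃ₜ (E × ℂ), (∀ p, p.2.re ≤ 0 → Ψ p = p) ∧ ∀ p, 0 < p.2.re →
      0 < (Ψ p).2.re ∧ ((Ψ p).2.im = 0 ↔ (φ p).2.im = 0) := by
  obtain ⟨ℓ, hℓ⟩ := exists_common_scale φ.continuous h.fix φ.symm.continuous h.symm_fix
  have hs0 : ∀ p : E × ℂ, p.2 ≠ 0 → (φ.symm p).2 ≠ 0 :=
    fun p hp => h.ne_zero_of (by simpa using hp)
  have n1 : NearAxis (h.polarHomeomorph ℓ) (2 * Real.pi) :=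
    nearAxis_polarLift ℓ (hℓ _ (Or.inl rfl)) (hℓ _ (Or.inr rfl)) (fun _ => h.ne_zero) hs0
      φ.symm_apply_apply h.turnsBy (abs_turnAngle_le φ)
  have n2 : NearAxis (h.polarHomeomorph ℓ).symm (2 * Real.pi) :=
    nearAxis_polarLift ℓ (hℓ _ (Or.inr rfl)) (hℓ _ (Or.inl rfl)) hs0 (fun _ => h.ne_zero)
      φ.apply_symm_apply (h.turnsBy.symm fun p => h.ne_zero_of) fun p => by
        rw [abs_neg]; exact abs_turnAngle_le φ _
  obtain ⟨b, hb, hb0, hbt⟩ := exists_continuous_tan_bound (h.polarHomeomorph ℓ)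
    fun x => h.abs_lt_of_polarHomeomorph_fst ℓ
  obtain ⟨N, hN, hN', hNΦ⟩ := exists_fixesEnds (h.polarHomeomorph ℓ) _ n1 n2 b hb hb0
    fun θ z hθ => ⟨h.abs_lt_of_polarHomeomorph_fst ℓ hθ, hbt θ z hθ⟩
  obtain ⟨Ψ, hΨ, hΨ'⟩ := exists_homeomorph_halfExtend ℓ N hN hN'
  refine ⟨Ψ, hΨ, fun p hp => ⟨(hΨ' p hp).1, (hΨ' p hp).2.trans ?_⟩⟩
  have h0 : p.2 ≠ 0 := fun h' => by simp [h'] at hp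
  have hθ := Complex.abs_arg_lt_pi_div_two_iff.2 (Or.inl hp)
  rw [← Complex.tan_arg, hNΦ _ _ hθ, h.polarHomeomorph_fst ℓ hθ]
  have hP : polarCover ℓ (Complex.arg p.2, ℓ.symm (-Real.log ‖p.2‖), p.1) = p := by
    refine Prod.ext rfl ?_
    simp only [polarCover, OrderIso.apply_symm_apply, neg_neg]
    exact Complex.exp_log h0
  rw [hP, Complex.arg_eq_zero_iff]
  have hsl := Complex.mem_slitPlane_iff.1 (h.mem_slitPlane h0 hp.le)
  constructor
  · exact fun h' => h'.2
  · intro h'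
    exact ⟨(hsl.resolve_right (by simpa using h')).le, h'⟩

end HalfSpace

section Crossing

set_option linter.unusedSectionVars false

variable {E : Type*} [NormedAddCommGroup E]

/-- Scaling of the real and imaginary parts by nonzero reals. -/
noncomputable def scaleParts (E : Type*) [TopologicalSpace E] {a b : ℝ} (ha : a ≠ 0)
    (hb : b ≠ 0) : (E × ℂ) ≃ₜ (E × ℂ) where
  toFun p := (p.1, ((a * p.2.re : ℝ) : ℂ) + ((b * p.2.im : ℝ) : ℂ) * Complex.I)
  invFun p := (p.1, ((a⁻¹ * p.2.re : ℝ) : ℂ) + ((b⁻¹ * p.2.im : ℝ) : ℂ) * Complex.I)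
  left_inv p := Prod.ext rfl (Complex.ext (by simp [ha]) (by simp [hb]))
  right_inv p := Prod.ext rfl (Complex.ext (by simp [ha]) (by simp [hb]))
  continuous_toFun := by fun_prop
  continuous_invFun := by fun_prop

@[simp]
lemma scaleParts_re {a b : ℝ} (ha : a ≠ 0) (hb : b ≠ 0) (p : E × ℂ) :
    (scaleParts E ha hb p).2.re = a * p.2.re := by simp [scaleParts]

@[simp]
lemma scaleParts_im {a b : ℝ} (ha : a ≠ 0) (hb : b ≠ 0) (p : E × ℂ) :
    (scaleParts E ha hb p).2.im = b * p.2.im := by simp [scaleParts]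

/-- Negation of the complex coordinate. -/
noncomputable def negSnd (E : Type*) [TopologicalSpace E] : (E × ℂ) ≃ₜ (E × ℂ) :=
  (Homeomorph.refl E).prodCongr (Homeomorph.neg ℂ)

@[simp]
lemma negSnd_apply (p : E × ℂ) : negSnd E p = (p.1, -p.2) := rfl

variable {φ : (E × ℂ) ≃ₜ (E × ℂ)}

lemma Aligned.conj_negSnd (h : Aligned φ) : Aligned ((negSnd E).trans (φ.trans (negSnd E))) where
  fix y := by simp [h.fix]
  im_pos p hp hi := by
    simpa using h.im_neg (p.1, -p.2) (by simpa using hp) (by simpa using hi)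
  im_neg p hp hi := by
    simpa using h.im_pos (p.1, -p.2) (by simpa using hp) (by simpa using hi)
  re_pos p hp hi := by
    simpa using h.re_neg (p.1, -p.2) (by simpa using hp) (by simpa using hi)
  re_neg p hp hi := by
    simpa using h.re_pos (p.1, -p.2) (by simpa using hp) (by simpa using hi)

theorem Aligned.exists_crossing [ProperSpace E] (h : Aligned φ) :
    ∃ Ω : (E × ℂ) ≃ₜ (E × ℂ), ∀ p, ((Ω p).2.re = 0 ↔ p.2.re = 0) ∧
      ((Ω p).2.im = 0 ↔ (φ p).2.im = 0) := by
  obtain ⟨Ψ, h1, h2⟩ := h.exists_straightening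
  obtain ⟨Ψ', h1', h2'⟩ := h.conj_negSnd.exists_straightening
  refine ⟨((negSnd E).trans (Ψ'.trans (negSnd E))).trans Ψ, fun p => ?_⟩
  simp only [Homeomorph.trans_apply]
  rcases lt_trichotomy p.2.re 0 with hp | hp | hp
  · obtain ⟨h3, h4⟩ := h2' (negSnd E p) (by simpa using hp)
    rw [h1 (negSnd E (Ψ' (negSnd E p))) (by simpa using h3.le)]
    simp only [Homeomorph.trans_apply, negSnd_apply, neg_neg, Complex.neg_re, Complex.neg_im,
      neg_eq_zero] at h3 h4 ⊢
    exact ⟨iff_of_false h3.ne' hp.ne, h4⟩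
  · rw [h1' (negSnd E p) (by simp [hp]), h1 (negSnd E (negSnd E p)) (by simp [hp])]
    simp only [negSnd_apply, neg_neg, hp, true_and]
    rcases lt_trichotomy p.2.im 0 with hi | hi | hi
    · exact iff_of_false hi.ne (h.im_neg p hp hi).ne
    · have : p = (p.1, 0) := Prod.ext rfl (Complex.ext hp hi)
      rw [this, h.fix]
    · exact iff_of_false hi.ne' (h.im_pos p hp hi).ne'
  · rw [h1' (negSnd E p) (by simpa using hp.le)]
    obtain ⟨h3, h4⟩ := h2 p hp
    simp only [negSnd_apply, neg_neg]
    exact ⟨iff_of_false h3.ne' hp.ne', h4⟩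

lemma IsPreconnected.pos_or_neg {X : Type*} [TopologicalSpace X] {S : Set X}
    (hS : IsPreconnected S) {s : X → ℝ} (hs : ContinuousOn s S) (h0 : ∀ x ∈ S, s x ≠ 0) :
    (∀ x ∈ S, 0 < s x) ∨ ∀ x ∈ S, s x < 0 := by
  by_contra! hc
  obtain ⟨⟨x, hx, hx0⟩, y, hy, hy0⟩ := hc
  obtain ⟨z, hz, hz0⟩ := hS.intermediate_value hx hy hs ⟨hx0, hy0⟩
  exact h0 z hz hz0

lemma exists_sign_of_linear {V : Type*} [AddCommGroup V] [Module ℝ V] [TopologicalSpace V]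
    [ContinuousAdd V] [ContinuousSMul ℝ V] (a b : V →ₗ[ℝ] ℝ) {s : V → ℝ} (hs : Continuous s)
    (h : ∀ q, a q = 0 → (s q = 0 ↔ b q = 0)) (hpos : ∃ q, a q = 0 ∧ 0 < s q)
    (hneg : ∃ q, a q = 0 ∧ s q < 0) :
    ∃ ε : ℝ, (ε = 1 ∨ ε = -1) ∧ (∀ q, a q = 0 → 0 < b q → 0 < ε * s q) ∧
      ∀ q, a q = 0 → b q < 0 → ε * s q < 0 := by
  have c1 : Convex ℝ ({q | a q = 0} ∩ {q | 0 < b q}) :=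
    (convex_hyperplane a.isLinear 0).inter (convex_halfSpace_gt b.isLinear 0)
  have c2 : Convex ℝ ({q | a q = 0} ∩ {q | b q < 0}) :=
    (convex_hyperplane a.isLinear 0).inter (convex_halfSpace_lt b.isLinear 0)
  have d1 := c1.isPreconnected.pos_or_neg hs.continuousOn fun q hq h0 =>
    hq.2.ne' ((h q hq.1).1 h0)
  have d2 := c2.isPreconnected.pos_or_neg hs.continuousOn fun q hq h0 =>
    hq.2.ne ((h q hq.1).1 h0)
  obtain ⟨q, hq, hq'⟩ := hpos
  obtain ⟨r, hr, hr'⟩ := hneg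
  have e1 : b q ≠ 0 := fun h0 => hq'.ne' ((h q hq).2 h0)
  have e2 : b r ≠ 0 := fun h0 => hr'.ne ((h r hr).2 h0)
  rcases d1 with d1 | d1 <;> rcases d2 with d2 | d2
  · rcases e2.lt_or_gt with e | e
    · exact absurd (d2 r ⟨hr, e⟩) hr'.not_gt
    · exact absurd (d1 r ⟨hr, e⟩) hr'.not_gt
  · exact ⟨1, Or.inl rfl, fun x hx hx' => by simpa using d1 x ⟨hx, hx'⟩,
      fun x hx hx' => by simpa using d2 x ⟨hx, hx'⟩⟩
  · exact ⟨-1, Or.inr rfl, fun x hx hx' => by simpa using d1 x ⟨hx, hx'⟩,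
      fun x hx hx' => by simpa using d2 x ⟨hx, hx'⟩⟩
  · rcases e1.lt_or_gt with e | e
    · exact absurd (d2 q ⟨hq, e⟩) hq'.not_gt
    · exact absurd (d1 q ⟨hq, e⟩) hq'.not_gt

/-- Two hyperplanes that agree with coordinate hyperplanes in charts with a common axis, and
each of which meets both sides of the other, can be straightened simultaneously. -/
theorem exists_simultaneous_chart [NormedSpace ℝ E] [ProperSpace E] {X : Type*}
    [TopologicalSpace X] {H₁ H₂ : Set X} (g f : X ≃ₜ (E × ℂ)) (hg : ∀ x, x ∈ H₁ ↔ (g x).2.re = 0)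
    (hg' : ∀ x, x ∈ H₁ ∩ H₂ ↔ (g x).2 = 0) (hf : ∀ x, x ∈ H₂ ↔ (f x).2.im = 0)
    (hf' : ∀ x, x ∈ H₁ ∩ H₂ ↔ (f x).2 = 0)
    (h1 : ∃ x ∈ H₂, 0 < (g x).2.re) (h2 : ∃ x ∈ H₂, (g x).2.re < 0)
    (h3 : ∃ x ∈ H₁, 0 < (f x).2.im) (h4 : ∃ x ∈ H₁, (f x).2.im < 0) :
    ∃ e : X ≃ₜ (E × ℂ), (∀ x, x ∈ H₁ ↔ (e x).2.re = 0) ∧ ∀ x, x ∈ H₂ ↔ (e x).2.im = 0 := by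
  let a : E × ℂ →ₗ[ℝ] ℝ := Complex.reLm ∘ₗ LinearMap.snd ℝ E ℂ
  let b : E × ℂ →ₗ[ℝ] ℝ := Complex.imLm ∘ₗ LinearMap.snd ℝ E ℂ
  have ha : ∀ q, a q = q.2.re := fun q => rfl
  have hb : ∀ q, b q = q.2.im := fun q => rfl
  obtain ⟨ε, hε, p1, p2⟩ := exists_sign_of_linear b a
    (s := fun q => (g (f.symm q)).2.re) (by fun_prop) (fun q hq => by
      have hq' : f.symm q ∈ H₂ := (hf _).2 (by rw [Homeomorph.apply_symm_apply]; exact hq)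
      rw [← hg]
      constructor
      · intro h
        have := (hf' _).1 ⟨h, hq'⟩
        rw [Homeomorph.apply_symm_apply] at this
        simp [ha, this]
      · intro h
        refine ((hf' (f.symm q)).2 ?_).1
        rw [Homeomorph.apply_symm_apply]
        exact Complex.ext h hq)
    (by
      obtain ⟨x, hx, hx'⟩ := h1
      exact ⟨f x, (hf x).1 hx, by simpa using hx'⟩)
    (by
      obtain ⟨x, hx, hx'⟩ := h2
      exact ⟨f x, (hf x).1 hx, by simpa using hx'⟩)
  obtain ⟨δ, hδ, q1, q2⟩ := exists_sign_of_linear a b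
    (s := fun q => (f (g.symm q)).2.im) (by fun_prop) (fun q hq => by
      have hq' : g.symm q ∈ H₁ := (hg _).2 (by rw [Homeomorph.apply_symm_apply]; exact hq)
      rw [← hf]
      constructor
      · intro h
        have := (hg' _).1 ⟨hq', h⟩
        rw [Homeomorph.apply_symm_apply] at this
        simp [hb, this]
      · intro h
        refine ((hg' (g.symm q)).2 ?_).2
        rw [Homeomorph.apply_symm_apply]
        exact Complex.ext hq h)
    (by
      obtain ⟨x, hx, hx'⟩ := h3
      exact ⟨g x, (hg x).1 hx, by simpa using hx'⟩)
    (by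
      obtain ⟨x, hx, hx'⟩ := h4
      exact ⟨g x, (hg x).1 hx, by simpa using hx'⟩)
  have hε0 : ε ≠ 0 := by rcases hε with rfl | rfl <;> norm_num
  have hδ0 : δ ≠ 0 := by rcases hδ with rfl | rfl <;> norm_num
  have z1 : ∀ y, (f (g.symm (y, 0))).2 = 0 := fun y => by
    rw [← hf', hg', Homeomorph.apply_symm_apply]
  have z2 : ∀ y, (g (f.symm (y, 0))).2 = 0 := fun y => by
    rw [← hg', hf', Homeomorph.apply_symm_apply]
  let κ : E ≃ₜ E :=
    { toFun := fun y => (g (f.symm (y, 0))).1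
      invFun := fun y => (f (g.symm (y, 0))).1
      left_inv := fun y => by
        have : ((g (f.symm (y, 0))).1, (0 : ℂ)) = g (f.symm (y, 0)) := Prod.ext rfl (z2 y).symm
        simp [this]
      right_inv := fun y => by
        have : ((f (g.symm (y, 0))).1, (0 : ℂ)) = f (g.symm (y, 0)) := Prod.ext rfl (z1 y).symm
        simp [this]
      continuous_toFun := by fun_prop
      continuous_invFun := by fun_prop }
  let φ : (E × ℂ) ≃ₜ (E × ℂ) :=
    ((g.symm.trans f).trans (κ.prodCongr (Homeomorph.refl ℂ))).trans (scaleParts E hε0 hδ0)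
  have h_fst : ∀ p, (φ p).1 = κ (f (g.symm p)).1 := fun p => rfl
  have h_re : ∀ p, (φ p).2.re = ε * (f (g.symm p)).2.re := fun p => scaleParts_re hε0 hδ0 _
  have h_im : ∀ p, (φ p).2.im = δ * (f (g.symm p)).2.im := fun p => scaleParts_im hε0 hδ0 _
  have hfim : ∀ p, (φ p).2.im = 0 ↔ (f (g.symm p)).2.im = 0 := fun p => by
    rw [h_im]; simp [hδ0]
  have key1 : ∀ p, (φ p).2.im = 0 → 0 < (φ p).2.re → 0 < p.2.re := by
    intro p hp hp'
    rw [hfim] at hp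
    rw [h_re] at hp'
    rcases hε with rfl | rfl
    · simpa using p1 (f (g.symm p)) hp (by simpa [ha] using hp')
    · simpa using p2 (f (g.symm p)) hp (by simpa [ha] using hp')
  have key2 : ∀ p, (φ p).2.im = 0 → (φ p).2.re < 0 → p.2.re < 0 := by
    intro p hp hp'
    rw [hfim] at hp
    rw [h_re] at hp'
    rcases hε with rfl | rfl
    · simpa using p2 (f (g.symm p)) hp (by simpa [ha] using hp')
    · simpa using p1 (f (g.symm p)) hp (by simpa [ha] using hp')
  have hal : Aligned φ :=
    { fix := fun y => by
        refine Prod.ext ?_ (Complex.ext ?_ ?_)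
        · rw [h_fst]; exact κ.right_inv y
        · rw [h_re, z1]; simp
        · rw [h_im, z1]; simp
      im_pos := fun p hp hp' => by rw [h_im]; exact q1 p hp hp'
      im_neg := fun p hp hp' => by rw [h_im]; exact q2 p hp hp'
      re_pos := key1
      re_neg := key2 }
  obtain ⟨Ω, hΩ⟩ := hal.exists_crossing
  refine ⟨g.trans Ω, fun x => ?_, fun x => ?_⟩
  · rw [hg, Homeomorph.trans_apply, (hΩ _).1]
  · rw [hf, Homeomorph.trans_apply, (hΩ _).2, hfim, Homeomorph.symm_apply_apply]

end Crossing

section Charts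

/-- Splitting off the first coordinate of `ℝᵏ⁺¹`. -/
def headTail (k : ℕ) : (Fin (k + 1) → ℝ) ≃ₜ ℝ × (Fin k → ℝ) where
  toFun x := (x 0, fun i => x i.succ)
  invFun p := Fin.cons p.1 p.2
  left_inv x := by
    funext i
    induction i using Fin.cases <;> rfl
  right_inv _ := rfl
  continuous_toFun := by fun_prop
  continuous_invFun := by
    refine continuous_pi fun i => ?_
    induction i using Fin.cases with
    | zero => exact continuous_fst
    | succ j => exact (continuous_apply j).comp continuous_snd

/-- Combining the first two coordinates of `ℝᵐ⁺²` into a complex number. -/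
noncomputable def tailComplex (m : ℕ) : (Fin (m + 2) → ℝ) ≃ₜ (Fin m → ℝ) × ℂ where
  toFun x := (fun i => x i.succ.succ, ⟨x 0, x 1⟩)
  invFun p := Fin.cons p.2.re (Fin.cons p.2.im p.1)
  left_inv x := by
    funext i
    induction i using Fin.cases with
    | zero => rfl
    | succ j => induction j using Fin.cases <;> rfl
  right_inv _ := rfl
  continuous_toFun := by
    refine (by fun_prop : Continuous fun x : Fin (m + 2) → ℝ => fun i : Fin m =>
      x i.succ.succ).prodMk ?_
    exact Complex.equivRealProdCLM.symm.continuous.comp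
      (by fun_prop : Continuous fun x : Fin (m + 2) → ℝ => (x 0, x 1))
  continuous_invFun := by
    refine continuous_pi fun i => ?_
    induction i using Fin.cases with
    | zero => exact Complex.continuous_re.comp continuous_snd
    | succ j =>
      induction j using Fin.cases with
      | zero => exact Complex.continuous_im.comp continuous_snd
      | succ l => exact (continuous_apply l).comp continuous_fst

/-- Exchanging the real and imaginary parts of the complex coordinate. -/
noncomputable def swapReIm (E : Type*) [TopologicalSpace E] : (E × ℂ) ≃ₜ (E × ℂ) where
  toFun p := (p.1, ⟨p.2.im, p.2.re⟩)
  invFun p := (p.1, ⟨p.2.im, p.2.re⟩)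
  left_inv _ := rfl
  right_inv _ := rfl
  continuous_toFun := continuous_fst.prodMk (Complex.equivRealProdCLM.symm.continuous.comp
    ((Complex.continuous_im.comp continuous_snd).prodMk (Complex.continuous_re.comp continuous_snd)))
  continuous_invFun := continuous_fst.prodMk (Complex.equivRealProdCLM.symm.continuous.comp
    ((Complex.continuous_im.comp continuous_snd).prodMk (Complex.continuous_re.comp continuous_snd)))

lemma mem_coordHyp_zero {k : ℕ} {x : Fin (k + 1) → ℝ} : x ∈ coordHyp (k + 1) 0 ↔ x 0 = 0 :=
  ⟨fun h => h (Nat.succ_pos k), fun h _ => h⟩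

lemma mem_coordHyp_one {m : ℕ} {x : Fin (m + 2) → ℝ} : x ∈ coordHyp (m + 2) 1 ↔ x 1 = 0 :=
  ⟨fun h => h (by omega), fun h _ => h⟩

/-- A hyperplane chart of a space restricts to a homeomorphism from the hyperplane. -/
def zeroSetHomeo {X F : Type*} [TopologicalSpace X] [TopologicalSpace F] {H : Set X}
    (e : X ≃ₜ ℝ × F) (he : ∀ x, x ∈ H ↔ (e x).1 = 0) : H ≃ₜ F where
  toFun x := (e x).2
  invFun t := ⟨e.symm (0, t), by rw [he, e.apply_symm_apply]⟩
  left_inv x := by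
    have h : ((0 : ℝ), (e x).2) = e x := Prod.ext ((he x).1 x.2).symm rfl
    exact Subtype.ext (by simp only [h, e.symm_apply_apply])
  right_inv t := by simp
  continuous_toFun := by fun_prop
  continuous_invFun := by fun_prop

lemma IsTopoplane.exists_chart {k : ℕ} {H : Set (Fin (k + 1) → ℝ)} (hH : IsTopoplane H) :
    ∃ e : (Fin (k + 1) → ℝ) ≃ₜ ℝ × (Fin k → ℝ), ∀ x, x ∈ H ↔ (e x).1 = 0 := by
  obtain ⟨e, he⟩ := hH
  refine ⟨e.trans (headTail k), fun x => ?_⟩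
  rw [← e.injective.mem_set_image, he, mem_coordHyp_zero]
  rfl

lemma IsTopoplane.ne_univ {k : ℕ} {H : Set (Fin (k + 1) → ℝ)} (hH : IsTopoplane H) :
    H ≠ univ := by
  rintro rfl
  obtain ⟨e, he⟩ := hH.exists_chart
  have := (he (e.symm (1, 0))).1 (mem_univ _)
  simp at this

/-- A topoplane together with a relative topoplane in it can be carried to `{x₁ = 0}` and
`{x₁ = x₂ = 0}`. -/
lemma IsTopoplane.exists_flag_chart {k : ℕ} {H Z : Set (Fin (k + 1) → ℝ)} (hH : IsTopoplane H)
    (hZ : IsRelTopoplane H Z) : ∃ m, k = m + 1 ∧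
      ∃ g : (Fin (k + 1) → ℝ) ≃ₜ (Fin m → ℝ) × ℂ,
        (∀ x, x ∈ H ↔ (g x).2.re = 0) ∧ ∀ x, x ∈ Z ↔ (g x).2 = 0 := by
  obtain ⟨hZH, d, hd, ψ, hψ⟩ := hZ
  obtain ⟨e, he⟩ := hH.exists_chart
  obtain rfl : k = d := eq_of_homeomorph_pi ((zeroSetHomeo e he).symm.trans ψ)
  obtain ⟨m, rfl⟩ : ∃ m, k = m + 1 := ⟨k - 1, by omega⟩
  let α : (Fin (m + 1) → ℝ) ≃ₜ (Fin (m + 1) → ℝ) := (zeroSetHomeo e he).symm.trans ψ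
  let g : (Fin (m + 2) → ℝ) ≃ₜ (Fin m → ℝ) × ℂ :=
    ((e.trans ((Homeomorph.refl ℝ).prodCongr α)).trans (headTail (m + 1)).symm).trans
      (tailComplex m)
  have h_re : ∀ x, (g x).2.re = (e x).1 := fun x => rfl
  have h_im : ∀ x, (g x).2.im = α (e x).2 0 := fun x => rfl
  have hα : ∀ x (hx : x ∈ H), α (e x).2 = ψ ⟨x, hx⟩ := fun x hx =>
    congrArg ψ ((zeroSetHomeo e he).symm_apply_apply ⟨x, hx⟩)
  have hZ' : ∀ x (hx : x ∈ H), x ∈ Z ↔ ψ ⟨x, hx⟩ 0 = 0 := fun x hx => by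
    rw [← mem_coordHyp_zero, ← hψ, ψ.injective.mem_set_image]
    rfl
  refine ⟨m, rfl, g, he, fun x => ⟨fun hx => ?_, fun hx => ?_⟩⟩
  · refine Complex.ext ((he x).1 (hZH hx)) ?_
    rw [h_im, hα x (hZH hx)]
    exact (hZ' x (hZH hx)).1 hx
  · have hxH : x ∈ H := (he x).2 (congrArg Complex.re hx)
    rw [hZ' x hxH, ← hα, ← h_im, hx]
    rfl

lemma exists_mem_neg_of_closure_component {X : Type*} [TopologicalSpace X] {H₁ H₂ : Set X}
    {s : X → ℝ} (hs : Continuous s) (h : ∀ x, x ∈ H₁ ↔ s x = 0) (hneg : ∃ x, s x < 0)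
    (hcl : ∀ x ∉ H₁ ∪ H₂,
      (closure (connectedComponentIn (H₁ ∪ H₂)ᶜ x) ∩ (H₂ \ H₁)).Nonempty) :
    ∃ x ∈ H₂, s x < 0 := by
  by_contra! hc
  obtain ⟨x, hx⟩ := hneg
  have hxc : x ∈ (H₁ ∪ H₂)ᶜ := by
    rintro (h1 | h2)
    · exact hx.ne ((h x).1 h1)
    · exact (hc x h2).not_gt hx
  obtain ⟨y, hy, hy2, hy1⟩ := hcl x hxc
  have hsub : connectedComponentIn (H₁ ∪ H₂)ᶜ x ⊆ {z | s z ≤ 0} := by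
    rcases isPreconnected_connectedComponentIn.pos_or_neg hs.continuousOn
      (fun z hz h0 => (connectedComponentIn_subset _ x hz : z ∉ H₁ ∪ H₂) (Or.inl ((h z).2 h0))) with hp | hp
    · exact absurd (hp x (mem_connectedComponentIn hxc)) hx.not_gt
    · exact fun z hz => (hp z hz).le
  have hle : s y ≤ 0 := closure_minimal hsub (isClosed_le hs continuous_const) hy
  exact hy1 ((h y).2 (le_antisymm hle (hc y hy2)))

lemma closure_component_inter_diff_nonempty {X : Type*} [TopologicalSpace X] {n : ℕ}
    {H₁ H₂ : Set X} (e : X ≃ₜ (Fin n → ℝ)) {i j : Fin n} (hij : i ≠ j)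
    (h1 : ∀ x, x ∈ H₁ ↔ e x i = 0) (h2 : ∀ x, x ∈ H₂ ↔ e x j = 0) {x : X}
    (hx : x ∉ H₁ ∪ H₂) :
    (closure (connectedComponentIn (H₁ ∪ H₂)ᶜ x) ∩ (H₁ \ H₂)).Nonempty := by
  have hxi : e x i ≠ 0 := fun h => hx (Or.inl ((h1 x).2 h))
  have hxj : e x j ≠ 0 := fun h => hx (Or.inr ((h2 x).2 h))
  let γ : ℝ → X := fun t => e.symm (Function.update (e x) i (t * e x i))
  have hγ : Continuous γ := e.symm.continuous.comp
    (continuous_const.update i (continuous_id.mul continuous_const))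
  have hγi : ∀ t, e (γ t) i = t * e x i := fun t => by simp [γ]
  have hγj : ∀ t, e (γ t) j = e x j := fun t => by simp [γ, hij.symm]
  have hγ2 : ∀ t, γ t ∉ H₂ := fun t => by rwa [h2, hγj]
  have hsub : γ '' Ioc 0 1 ⊆ connectedComponentIn (H₁ ∪ H₂)ᶜ x := by
    refine (isPreconnected_Ioc.image γ hγ.continuousOn).subset_connectedComponentIn
      ⟨1, ⟨one_pos, le_rfl⟩, by simp [γ]⟩ ?_
    rintro _ ⟨t, ht, rfl⟩ (h | h)
    · rw [h1, hγi] at h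
      exact mul_ne_zero ht.1.ne' hxi h
    · exact hγ2 t h
  refine ⟨γ 0, closure_mono hsub ?_, (h1 _).2 (by rw [hγi, zero_mul]), hγ2 0⟩
  refine image_closure_subset_closure_image hγ ⟨0, ?_, rfl⟩
  rw [closure_Ioc zero_ne_one]
  exact ⟨le_rfl, zero_le_one⟩

end Charts

section ArrangementCrossing

lemma IsArrangement.isRelTopoplane {n : ℕ} {𝓗 : Set (Set (Fin n → ℝ))} (h𝓗 : IsArrangement 𝓗)
    {H Y : Set (Fin n → ℝ)} (hH : H ∈ 𝓗) (hY : Y ∈ 𝓗) (hne : (H ∩ Y).Nonempty)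
    (hYH : ¬ Y ⊆ H) : IsRelTopoplane Y (H ∩ Y) := by
  rcases h𝓗.2.2 H hH Y ⟨⟨{Y}, singleton_subset_iff.2 hY, (sInter_singleton Y).symm⟩,
    hne.mono inter_subset_right⟩ with h | h | h
  · exact absurd h hYH
  · exact absurd h hne.ne_empty
  · exact h

lemma not_subset_of_closure_component {k : ℕ} {H₁ H₂ : Set (Fin (k + 1) → ℝ)}
    (hH₂ : IsTopoplane H₂)
    (hcl : ∀ x ∉ H₁ ∪ H₂,
      (closure (connectedComponentIn (H₁ ∪ H₂)ᶜ x) ∩ (H₁ \ H₂)).Nonempty) :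
    ¬ H₁ ⊆ H₂ := by
  intro hsub
  obtain ⟨x, hx⟩ := (ne_univ_iff_exists_notMem H₂).1 hH₂.ne_univ
  obtain ⟨y, -, hy1, hy2⟩ := hcl x (by rwa [union_eq_self_of_subset_left hsub])
  exact hy2 (hsub hy1)

lemma Crosses.exists_coords {k : ℕ} {H₁ H₂ : Set (Fin (k + 1) → ℝ)} (hH₂ : IsTopoplane H₂)
    (h : Crosses H₁ H₂) : ∃ e : (Fin (k + 1) → ℝ) ≃ₜ (Fin (k + 1) → ℝ), ∃ j : Fin (k + 1),
      0 ≠ j ∧ (∀ x, x ∈ H₁ ↔ e x 0 = 0) ∧ ∀ x, x ∈ H₂ ↔ e x j = 0 := by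
  obtain ⟨e, he1, he2⟩ := h
  obtain _ | m := k
  · refine absurd (eq_univ_of_forall fun x => ?_) hH₂.ne_univ
    rw [← e.injective.mem_set_image, he2]
    exact fun h => absurd h (by omega)
  · refine ⟨e, 1, zero_ne_one, fun x => ?_, fun x => ?_⟩
    · rw [← e.injective.mem_set_image, he1, mem_coordHyp_zero]
    · rw [← e.injective.mem_set_image, he2, mem_coordHyp_one]

lemma crosses_of_chart {m : ℕ} {H₁ H₂ : Set (Fin (m + 2) → ℝ)}
    (e : (Fin (m + 2) → ℝ) ≃ₜ (Fin m → ℝ) × ℂ) (h1 : ∀ x, x ∈ H₁ ↔ (e x).2.re = 0)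
    (h2 : ∀ x, x ∈ H₂ ↔ (e x).2.im = 0) : Crosses H₁ H₂ := by
  let e' := e.trans (tailComplex m).symm
  refine ⟨e', ?_, ?_⟩
  · ext y
    obtain ⟨x, rfl⟩ := e'.surjective y
    rw [e'.injective.mem_set_image, mem_coordHyp_zero, h1]
    rfl
  · ext y
    obtain ⟨x, rfl⟩ := e'.surjective y
    rw [e'.injective.mem_set_image, mem_coordHyp_one, h2]
    rfl

lemma Homeomorph.exists_re_lt_zero {X E : Type*} [TopologicalSpace X] [TopologicalSpace E]
    [Nonempty E] (g : X ≃ₜ E × ℂ) {c : ℝ} (hc : c ≠ 0) : ∃ x, c * (g x).2.re < 0 := by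
  obtain ⟨y⟩ := ‹Nonempty E›
  refine ⟨g.symm (y, ((-c : ℝ) : ℂ)), ?_⟩
  rw [g.apply_symm_apply, Complex.ofReal_re]
  nlinarith [mul_self_pos.2 hc]

lemma exists_mem_re_pos_and_neg {X E : Type*} [TopologicalSpace X] [TopologicalSpace E]
    [Nonempty E] {H₁ H₂ : Set X} (g : X ≃ₜ E × ℂ) (hg : ∀ x, x ∈ H₁ ↔ (g x).2.re = 0)
    (hcl : ∀ x ∉ H₁ ∪ H₂,
      (closure (connectedComponentIn (H₁ ∪ H₂)ᶜ x) ∩ (H₂ \ H₁)).Nonempty) :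
    (∃ x ∈ H₂, 0 < (g x).2.re) ∧ ∃ x ∈ H₂, (g x).2.re < 0 := by
  have key : ∀ c : ℝ, c ≠ 0 → ∃ x ∈ H₂, c * (g x).2.re < 0 := fun c hc =>
    exists_mem_neg_of_closure_component
      (continuous_const.mul (Complex.continuous_re.comp (continuous_snd.comp g.continuous)))
      (fun x => by simp [hg, hc]) (g.exists_re_lt_zero hc) hcl
  exact ⟨by simpa using key (-1) (by norm_num), by simpa using key 1 one_ne_zero⟩

end ArrangementCrossing

/-- distinct topoplanes `H₁`, `H₂` of an arrangement `𝓗` in `ℝⁿ` cross if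
and only if they intersect and every connected component of `ℝⁿ ∖ (H₁ ∪ H₂)` has closure
meeting both `H₁ ∖ H₂` and `H₂ ∖ H₁`. -/
theorem statement4 {n : ℕ} (hn : 1 ≤ n) (𝓗 : Set (Set (Fin n → ℝ)))
    (h𝓗 : IsArrangement 𝓗) (H₁ H₂ : Set (Fin n → ℝ))
    (h₁ : H₁ ∈ 𝓗) (h₂ : H₂ ∈ 𝓗) (hne : H₁ ≠ H₂) :
    Crosses H₁ H₂ ↔
      (H₁ ∩ H₂).Nonempty ∧
      ∀ x ∉ H₁ ∪ H₂,
        (closure (connectedComponentIn (H₁ ∪ H₂)ᶜ x) ∩ (H₁ \ H₂)).Nonempty ∧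
        (closure (connectedComponentIn (H₁ ∪ H₂)ᶜ x) ∩ (H₂ \ H₁)).Nonempty := by
  obtain ⟨k, rfl⟩ : ∃ k, n = k + 1 := ⟨n - 1, by omega⟩
  have t1 := h𝓗.2.1 H₁ h₁
  have t2 := h𝓗.2.1 H₂ h₂
  constructor
  · intro h
    obtain ⟨e, j, hj, he1, he2⟩ := h.exists_coords t2
    refine ⟨⟨e.symm 0, (he1 _).2 (by simp), (he2 _).2 (by simp)⟩, fun x hx => ⟨?_, ?_⟩⟩
    · exact closure_component_inter_diff_nonempty e hj he1 he2 hx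
    · rw [union_comm] at hx ⊢
      exact closure_component_inter_diff_nonempty e hj.symm he2 he1 hx
  · rintro ⟨hI, hcl⟩
    have c1 := fun x hx => (hcl x hx).1
    have c2 := fun x hx => (hcl x hx).2
    rw [union_comm] at c1
    have hI' : (H₂ ∩ H₁).Nonempty := by rwa [inter_comm]
    have n1 : ¬ H₁ ⊆ H₂ := not_subset_of_closure_component t2 fun x hx => (hcl x hx).1
    have n2 : ¬ H₂ ⊆ H₁ := not_subset_of_closure_component t1 (by rwa [union_comm] at c2)
    obtain ⟨m, rfl, g, hg, hg'⟩ := t1.exists_flag_chart (h𝓗.isRelTopoplane h₂ h₁ hI' n1)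
    obtain ⟨m', hm, f, hf, hf'⟩ := t2.exists_flag_chart (h𝓗.isRelTopoplane h₁ h₂ hI n2)
    obtain rfl : m = m' := by omega
    obtain ⟨a1, a2⟩ := exists_mem_re_pos_and_neg g hg c2
    obtain ⟨b1, b2⟩ := exists_mem_re_pos_and_neg f hf c1
    obtain ⟨e, he1, he2⟩ := exists_simultaneous_chart g (f.trans (swapReIm _)) hg
      (fun x => by rw [inter_comm, hg']) hf
      (fun x => by
        rw [hf', Complex.ext_iff, Complex.ext_iff]
        exact and_comm) a1 a2 b1 b2
    exact crosses_of_chart e he1 he2
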